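/- (Theorem 2.1, barrier height.) There exist N₁ < ∞ and a constant c > 0 such that for every integer N ≥ N₁ and every γ > 0 with γ̃₂ < γ̃ < 1, if κ ∈ (0,1) is the unique solution of γ̃ = π²/(4 K(κ)² (1+κ²)), then every 1-saddle A of V_γ satisfies | (V_γ(A) − V_γ(I^+))/N − 1/4 + (1/(3(1+κ²)))·[ (2+κ²)/(1+κ²) − 2 E(κ)/K(κ) ] | ≤ c κ²/N. -/

import Mathlib

/-- Local double-well potential `U(ξ) = ξ⁴/4 − ξ²/2`. -/
noncomputable def U (ξ : ℝ) : ℝ := ξ^4/4 - ξ^2/2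

/-- The potential `V_γ(x) = Σᵢ U(xᵢ) + (γ/4) Σᵢ (x_{i+1} − x_i)²` on `ℝ^Λ`, `Λ = ℤ/Nℤ`. -/
noncomputable def V (N : ℕ) [NeZero N] (γ : ℝ) (x : ZMod N → ℝ) : ℝ :=
  (∑ i : ZMod N, U (x i)) + γ/4 * ∑ i : ZMod N, (x (i+1) - x i)^2

/-- The configuration `I⁺ = (1,…,1)`. -/
def Iplus (N : ℕ) : ZMod N → ℝ := fun _ => 1

/-- The configuration `I⁻ = (−1,…,−1)`. -/
def Iminus (N : ℕ) : ZMod N → ℝ := fun _ => -1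

/-- The configuration `O = (0,…,0)`. -/
def Opoint (N : ℕ) : ZMod N → ℝ := fun _ => 0

/-- The local drift `f(ξ) = ξ − ξ³ = −U′(ξ)`. -/
def fdrift (ξ : ℝ) : ℝ := ξ - ξ^3

/-- The set of stationary points of `V_γ`. -/
noncomputable def statPts (N : ℕ) [NeZero N] (γ : ℝ) : Set (ZMod N → ℝ) :=
  {x | fderiv ℝ (V N γ) x = 0}

/-- The Hessian matrix of `V_γ` at `x`. -/
noncomputable def hess (N : ℕ) [NeZero N] (γ : ℝ) (x : ZMod N → ℝ) :
    Matrix (ZMod N) (ZMod N) ℝ :=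
  Matrix.of fun i j => fderiv ℝ (fun y => fderiv ℝ (V N γ) y (Pi.single i 1)) x (Pi.single j 1)

open Classical in
/-- Number of negative eigenvalues of a real symmetric matrix. -/
noncomputable def negCount {n : Type*} [Fintype n] [DecidableEq n] (A : Matrix n n ℝ) : ℕ :=
  if h : A.IsHermitian then (Finset.univ.filter fun i => h.eigenvalues i < 0).card else 0

/-- `x` is a `k`-saddle of `V_γ`: a stationary point with nondegenerate Hessian having
exactly `k` negative eigenvalues. -/
noncomputable def IsKSaddle (N : ℕ) [NeZero N] (γ : ℝ) (k : ℕ) (x : ZMod N → ℝ) : Prop :=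
  fderiv ℝ (V N γ) x = 0 ∧ (hess N γ x).det ≠ 0 ∧ negCount (hess N γ x) = k

/-- The rotation `R(x₁,…,x_N) = (x₂,…,x_N,x₁)`. -/
def rotMap (N : ℕ) : Function.End (ZMod N → ℝ) := fun x i => x (i + 1)

/-- The mirror symmetry `S(x₁,…,x_N) = (x_N,…,x₁)`, i.e. `(Sx)_i = x_{1−i}` mod `N`. -/
def mirMap (N : ℕ) : Function.End (ZMod N → ℝ) := fun x i => x (1 - i)

/-- The point symmetry `C(x) = −x`. -/
def negMap (N : ℕ) : Function.End (ZMod N → ℝ) := fun x => -x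

/-- The symmetry group `G` generated by `R`, `S` and `C` (as a monoid of maps; since the
generators have finite order this coincides with the generated group). -/
def symGroup (N : ℕ) : Submonoid (Function.End (ZMod N → ℝ)) :=
  Submonoid.closure {rotMap N, mirMap N, negMap N}

/-- The orbit of a configuration `x` under the symmetry group `G`. -/
def Gorbit (N : ℕ) (x : ZMod N → ℝ) : Set (ZMod N → ℝ) :=
  {y | ∃ g ∈ symGroup N, g x = y}

/-- The bifurcation values `γ_M = (1 − cos(2πM/N))⁻¹`. -/
noncomputable def gammaM (N M : ℕ) : ℝ := (1 - Real.cos (2 * Real.pi * M / N))⁻¹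

/-- Complete elliptic integral of the first kind. -/
noncomputable def ellK (κ : ℝ) : ℝ :=
  ∫ t in (0:ℝ)..(Real.pi/2), 1 / Real.sqrt (1 - κ^2 * Real.sin t ^ 2)

/-- Complete elliptic integral of the second kind. -/
noncomputable def ellE (κ : ℝ) : ℝ :=
  ∫ t in (0:ℝ)..(Real.pi/2), Real.sqrt (1 - κ^2 * Real.sin t ^ 2)

/-- The first derivative of `V_γ` at `x` in the direction `v`. -/
theorem fderiv_V_apply (N : ℕ) [NeZero N] (γ : ℝ) (x v : ZMod N → ℝ) :
    fderiv ℝ (V N γ) x v = (∑ i, (x i ^ 3 - x i) * v i)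
      + γ / 2 * ∑ i, (x (i + 1) - x i) * (v (i + 1) - v i) := by
  have hp : ∀ i : ZMod N, HasFDerivAt (fun y : ZMod N → ℝ => y i)
      (ContinuousLinearMap.proj (R := ℝ) (φ := fun _ : ZMod N => ℝ) i) x :=
    fun i => hasFDerivAt_apply i x
  have hA := HasFDerivAt.fun_sum (u := Finset.univ) (fun i _ =>
    (((hp i).pow 4).mul_const (1/4 : ℝ)).sub (((hp i).pow 2).mul_const (1/2 : ℝ)))
  have hB := (HasFDerivAt.fun_sum (u := Finset.univ) (fun i _ =>
    ((hp (i+1)).sub (hp i)).pow 2)).const_mul (γ/4)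
  have h := (hA.add hB).fderiv
  simp only [Pi.add_def, Pi.sub_def] at h
  have hV : V N γ = fun y => (∑ i, (y i ^ 4 * (1 / 4) - y i ^ 2 * (1 / 2)))
      + γ / 4 * ∑ i, (y (i + 1) - y i) ^ 2 := by
    ext y
    simp only [V, U]
    congr 1
    exact Finset.sum_congr rfl fun i _ => by ring
  rw [hV, h]
  simp only [add_apply, sum_apply, smul_apply, sub_apply, smul_eq_mul,
    ContinuousLinearMap.proj_apply, Finset.mul_sum]
  congr 1
  · refine Finset.sum_congr rfl fun l _ => ?_
    simp
    ring
  · refine Finset.sum_congr rfl fun l _ => ?_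
    simp
    ring

theorem sum_shift {N : ℕ} [NeZero N] (f : ZMod N → ℝ) : ∑ i, f (i + 1) = ∑ i, f i :=
  Equiv.sum_comp (Equiv.addRight (1 : ZMod N)) f

theorem sum_diff_mul_diff {N : ℕ} [NeZero N] (x v : ZMod N → ℝ) :
    ∑ i, (x (i + 1) - x i) * (v (i + 1) - v i)
      = ∑ i, (2 * x i - x (i + 1) - x (i - 1)) * v i := by
  have h1 := sum_shift fun i => (x i - x (i - 1)) * v i
  simp only [add_sub_cancel_right] at h1
  have h2 : ∀ i, (x (i + 1) - x i) * (v (i + 1) - v i)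
      = (x (i + 1) - x i) * v (i + 1) - (x (i + 1) - x i) * v i := fun i => by ring
  simp only [h2, Finset.sum_sub_distrib, h1]
  rw [← Finset.sum_sub_distrib]
  exact Finset.sum_congr rfl fun i _ => by ring

/-- The equation satisfied by the stationary points of `V_γ`. -/
theorem stationary_eq {N : ℕ} [NeZero N] {γ : ℝ} {x : ZMod N → ℝ}
    (hx : fderiv ℝ (V N γ) x = 0) (i : ZMod N) :
    γ / 2 * (2 * x i - x (i + 1) - x (i - 1)) = x i - x i ^ 3 := by
  have h := fderiv_V_apply N γ x (Pi.single i 1)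
  rw [hx, sum_diff_mul_diff] at h
  simp [Pi.single_apply] at h
  linarith

theorem hess_apply (N : ℕ) [NeZero N] (γ : ℝ) (x : ZMod N → ℝ) (i j : ZMod N) :
    hess N γ x i j = (∑ l, (3 * x l ^ 2 - 1) * (Pi.single (M := fun _ => ℝ) i 1 l
        * Pi.single (M := fun _ => ℝ) j 1 l))
      + γ / 2 * ∑ l, (Pi.single (M := fun _ => ℝ) j 1 (l + 1) - Pi.single (M := fun _ => ℝ) j 1 l)
        * (Pi.single (M := fun _ => ℝ) i 1 (l + 1) - Pi.single (M := fun _ => ℝ) i 1 l) := by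
  have hp : ∀ i : ZMod N, HasFDerivAt (fun y : ZMod N → ℝ => y i)
      (ContinuousLinearMap.proj (R := ℝ) (φ := fun _ : ZMod N => ℝ) i) x :=
    fun i => hasFDerivAt_apply i x
  simp only [hess, Matrix.of_apply, fderiv_V_apply]
  have hA := HasFDerivAt.fun_sum (u := Finset.univ) (fun l _ =>
      (((hp l).pow 3).sub (hp l)).mul_const (Pi.single (M := fun _ => ℝ) i 1 l))
  have hB := (HasFDerivAt.fun_sum (u := Finset.univ) (fun l _ =>
      ((hp (l+1)).sub (hp l)).mul_const
        (Pi.single (M := fun _ => ℝ) i 1 (l + 1) - Pi.single (M := fun _ => ℝ) i 1 l))).const_mul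
          (γ/2)
  have h := (hA.add hB).fderiv
  simp only [Pi.add_def, Pi.sub_def] at h
  rw [h]
  simp only [add_apply, sum_apply,
        smul_apply, sub_apply, smul_eq_mul,
        ContinuousLinearMap.proj_apply, Finset.mul_sum]
  congr 1
  · refine Finset.sum_congr rfl fun l _ => ?_
    simp
    ring
  · refine Finset.sum_congr rfl fun l _ => ?_
    ring

theorem hess_isHermitian (N : ℕ) [NeZero N] (γ : ℝ) (x : ZMod N → ℝ) :
    (hess N γ x).IsHermitian := by
  ext i j
  simp only [Matrix.conjTranspose_apply, star_trivial, hess_apply]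
  congr 1
  · exact Finset.sum_congr rfl fun l _ => by ring
  · congr 1
    exact Finset.sum_congr rfl fun l _ => by ring

theorem hess_quadratic (N : ℕ) [NeZero N] (γ : ℝ) (x y : ZMod N → ℝ) :
    dotProduct y ((hess N γ x).mulVec y) = (∑ l, (3 * x l ^ 2 - 1) * y l ^ 2)
      + γ / 2 * ∑ l, (y (l + 1) - y l) ^ 2 := by
  have hs : ∀ l, ∑ i, y i * Pi.single (M := fun _ => ℝ) i 1 l = y l := fun l => by
    simp [Pi.single_apply]
  have h1 : ∀ i j, y i * (hess N γ x i j * y j) =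
      (∑ l, (3 * x l ^ 2 - 1) * ((y i * Pi.single (M := fun _ => ℝ) i 1 l)
        * (y j * Pi.single (M := fun _ => ℝ) j 1 l)))
      + γ / 2 * ∑ l, ((y i * Pi.single (M := fun _ => ℝ) i 1 (l + 1)
          - y i * Pi.single (M := fun _ => ℝ) i 1 l))
        * (y j * Pi.single (M := fun _ => ℝ) j 1 (l + 1)
          - y j * Pi.single (M := fun _ => ℝ) j 1 l) := by
    intro i j
    rw [hess_apply, add_mul, mul_add, Finset.sum_mul, Finset.mul_sum, Finset.mul_sum,
      Finset.mul_sum, Finset.sum_mul, Finset.mul_sum]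
    congr 1
    · exact Finset.sum_congr rfl fun l _ => by ring
    · exact Finset.sum_congr rfl fun l _ => by ring
  simp only [dotProduct, Matrix.mulVec, Finset.mul_sum (Finset.univ) _ (y _), h1,
    Finset.sum_add_distrib]
  simp only [← Finset.mul_sum]
  congr 1
  · rw [Finset.sum_congr rfl (fun i _ => Finset.sum_comm), Finset.sum_comm]
    refine Finset.sum_congr rfl fun l _ => ?_
    simp only [← Finset.mul_sum, ← Finset.sum_mul, hs]
    ring
  · congr 1
    rw [Finset.sum_congr rfl (fun i _ => Finset.sum_comm), Finset.sum_comm]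
    refine Finset.sum_congr rfl fun l _ => ?_
    simp only [← Finset.mul_sum, ← Finset.sum_mul, Finset.sum_sub_distrib, hs]
    ring

theorem quadratic_eq_sum_eigenvalues {n : Type*} [Fintype n] [DecidableEq n]
    {A : Matrix n n ℝ} (hA : A.IsHermitian) (y : n → ℝ) :
    dotProduct y (A.mulVec y)
      = ∑ i, hA.eigenvalues i * (dotProduct (⇑(hA.eigenvectorBasis i)) y) ^ 2 := by
  have h := hA.eigenvectorBasis.sum_inner_mul_inner (WithLp.toLp 2 y) (WithLp.toLp 2 (A.mulVec y))
  have hinner : inner ℝ (WithLp.toLp 2 y) (WithLp.toLp 2 (A.mulVec y))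
      = dotProduct y (A.mulVec y) := by
    simp [EuclideanSpace.inner_eq_star_dotProduct, dotProduct_comm]
  rw [← hinner, ← h]
  refine Finset.sum_congr rfl fun i _ => ?_
  have h1 : inner ℝ (WithLp.toLp 2 y) (hA.eigenvectorBasis i)
      = dotProduct (⇑(hA.eigenvectorBasis i)) y := by
    simp [EuclideanSpace.inner_eq_star_dotProduct]
  have h2 : inner ℝ (hA.eigenvectorBasis i) (WithLp.toLp 2 (A.mulVec y))
      = hA.eigenvalues i * dotProduct (⇑(hA.eigenvectorBasis i)) y := by
    have : inner ℝ (hA.eigenvectorBasis i) (WithLp.toLp 2 (A.mulVec y))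
      = dotProduct (⇑(hA.eigenvectorBasis i)) (A.mulVec y) := by
      simp [EuclideanSpace.inner_eq_star_dotProduct, dotProduct_comm]
    rw [this, Matrix.dotProduct_mulVec, ← Matrix.mulVec_transpose]
    have ht : A.transpose = A := by simpa using hA.eq
    rw [ht, hA.mulVec_eigenvectorBasis, smul_dotProduct, smul_eq_mul]
  rw [h1, h2]
  ring

theorem exists_quadratic_neg {n : Type*} [Fintype n] [DecidableEq n]
    {A : Matrix n n ℝ} (hA : A.IsHermitian) (h : negCount A = 1) :
    ∃ y, dotProduct y (A.mulVec y) < 0 := by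
  rw [negCount, dif_pos hA, Finset.card_eq_one] at h
  obtain ⟨a, ha⟩ := h
  have hneg : hA.eigenvalues a < 0 := by
    have : a ∈ ({a} : Finset n) := Finset.mem_singleton_self a
    rw [← ha] at this
    simpa using this
  refine ⟨⇑(hA.eigenvectorBasis a), ?_⟩
  rw [hA.mulVec_eigenvectorBasis, dotProduct_smul, smul_eq_mul]
  refine mul_neg_of_neg_of_pos hneg ?_
  have h1 := hA.eigenvectorBasis.orthonormal.1 a
  have h2 : dotProduct (⇑(hA.eigenvectorBasis a)) (⇑(hA.eigenvectorBasis a))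
      = ‖hA.eigenvectorBasis a‖ ^ 2 := by
    rw [EuclideanSpace.norm_sq_eq]
    simp [dotProduct, sq]
  rw [h2, h1]
  norm_num

theorem exists_quadratic_nonneg {n : Type*} [Fintype n] [DecidableEq n]
    {A : Matrix n n ℝ} (hA : A.IsHermitian) (h : negCount A = 1) (u w : n → ℝ) :
    ∃ α β : ℝ, (α ≠ 0 ∨ β ≠ 0) ∧
      0 ≤ dotProduct (α • u + β • w) (A.mulVec (α • u + β • w)) := by
  rw [negCount, dif_pos hA, Finset.card_eq_one] at h
  obtain ⟨a, ha⟩ := h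
  have key : ∀ y, dotProduct (⇑(hA.eigenvectorBasis a)) y = 0 →
      0 ≤ dotProduct y (A.mulVec y) := by
    intro y hy
    rw [quadratic_eq_sum_eigenvalues hA]
    refine Finset.sum_nonneg fun i _ => ?_
    by_cases hi : i = a
    · subst hi
      simp [hy]
    · have : i ∉ ({a} : Finset n) := by simpa using hi
      rw [← ha] at this
      have h0 : 0 ≤ hA.eigenvalues i := by simpa using this
      positivity
  by_cases hu : dotProduct (⇑(hA.eigenvectorBasis a)) u = 0
  · exact ⟨1, 0, Or.inl one_ne_zero, key _ (by simp [hu])⟩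
  · refine ⟨-dotProduct (⇑(hA.eigenvectorBasis a)) w, dotProduct (⇑(hA.eigenvectorBasis a)) u,
      Or.inr hu, key _ ?_⟩
    simp only [dotProduct_add, dotProduct_smul, smul_eq_mul]
    ring

theorem exists_angle_add_one {N : ℕ} [NeZero N] (i : ZMod N) :
    ∃ k : ℕ, 2 * Real.pi * ((i + 1).val : ℝ) / N
      = 2 * Real.pi * (i.val : ℝ) / N + 2 * Real.pi / N - k * (2 * Real.pi) := by
  have hN : (N : ℝ) ≠ 0 := Nat.cast_ne_zero.mpr (NeZero.ne N)
  have h : (i + 1).val = (i.val + 1) % N := by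
    rw [← ZMod.val_natCast]
    congr 1
    simp
  have h2 := Nat.mod_add_div (i.val + 1) N
  rw [← h] at h2
  refine ⟨(i.val + 1) / N, ?_⟩
  have h3 : ((i + 1).val : ℝ) = (i.val : ℝ) + 1 - N * ((i.val + 1) / N : ℕ) := by
    have h4 : (((i + 1).val + N * ((i.val + 1) / N) : ℕ) : ℝ) = ((i.val + 1 : ℕ) : ℝ) := by
      rw [h2]
    push_cast at h4 ⊢
    linarith
  rw [h3]
  field_simp

theorem exists_fourier_mode (N : ℕ) [NeZero N] (hN : 2 ≤ N) :
    ∃ c : ZMod N → ℝ, c 0 = 1 ∧ ∑ i, c i = 0 ∧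
      ∑ i, (c (i + 1) - c i) ^ 2 = 2 * (1 - Real.cos (2 * Real.pi / N)) * ∑ i, c i ^ 2 := by
  set θ : ℝ := 2 * Real.pi / N with hθ
  let c : ZMod N → ℝ := fun i => Real.cos (2 * Real.pi * (i.val : ℝ) / N)
  have hrec : ∀ i, 2 * c i - c (i + 1) - c (i - 1) = 2 * (1 - Real.cos θ) * c i := by
    intro i
    obtain ⟨k, hk⟩ := exists_angle_add_one i
    obtain ⟨l, hl⟩ := exists_angle_add_one (i - 1)
    rw [sub_add_cancel] at hl
    have h1 : c i = Real.cos (2 * Real.pi * ((i - 1).val : ℝ) / N + θ) := by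
      simp only [c]
      rw [hl, Real.cos_sub_nat_mul_two_pi]
    have h2 : c (i + 1) = Real.cos (2 * Real.pi * ((i - 1).val : ℝ) / N + θ + θ) := by
      simp only [c]
      rw [hk, Real.cos_sub_nat_mul_two_pi, hl, sub_add_eq_add_sub, Real.cos_sub_nat_mul_two_pi]
    have h3 : c (i - 1) = Real.cos (2 * Real.pi * ((i - 1).val : ℝ) / N) := rfl
    rw [h1, h2, h3]
    set φ := 2 * Real.pi * ((i - 1).val : ℝ) / N
    simp only [Real.cos_add, Real.sin_add]
    linear_combination Real.cos φ * Real.sin_sq_add_cos_sq θ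
  have hcos : Real.cos θ < 1 := by
    have hN' : (2 : ℝ) ≤ N := by exact_mod_cast hN
    have h0 : 0 < θ := by positivity
    have h1 : θ ≤ Real.pi := by
      rw [hθ, div_le_iff₀ (by linarith)]
      nlinarith [Real.pi_pos]
    rw [← Real.cos_zero]
    exact Real.cos_lt_cos_of_nonneg_of_le_pi le_rfl h1 h0
  refine ⟨c, by simp [c], ?_, ?_⟩
  · have h1 : ∑ i, (2 * c i - c (i + 1) - c (i - 1)) = 2 * (1 - Real.cos θ) * ∑ i, c i := by
      rw [Finset.mul_sum]
      exact Finset.sum_congr rfl fun i _ => hrec i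
    have h2 : ∑ i, c (i - 1) = ∑ i, c i := by
      rw [← sum_shift fun i => c (i - 1)]
      simp
    rw [Finset.sum_sub_distrib, Finset.sum_sub_distrib, ← Finset.mul_sum, sum_shift, h2] at h1
    have h3 : 2 * (1 - Real.cos θ) * ∑ i, c i = 0 := by linarith
    rcases mul_eq_zero.mp h3 with h | h
    · linarith
    · exact h
  · have h1 := sum_diff_mul_diff c c
    simp only [← sq] at h1
    rw [h1, Finset.mul_sum]
    refine Finset.sum_congr rfl fun i _ => ?_
    rw [hrec]
    ring

/-- A saddle of index one cannot be uniformly small. -/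
theorem le_of_index_one {N : ℕ} [NeZero N] (hN : 2 ≤ N) {γ B : ℝ} {x : ZMod N → ℝ}
    (hγ : 0 < γ)
    (h : negCount (hess N γ x) = 1) (hB : ∀ i, |x i| ≤ B) :
    1 - γ * (1 - Real.cos (2 * Real.pi / N)) ≤ 3 * B ^ 2 := by
  obtain ⟨c, hc0, hcs, hcd⟩ := exists_fourier_mode N hN
  obtain ⟨α, β, hne, hq⟩ := exists_quadratic_nonneg (hess_isHermitian N γ x) h (fun _ => 1) c
  rw [hess_quadratic] at hq
  set y : ZMod N → ℝ := α • (fun _ => 1) + β • c with hy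
  have hyi : ∀ i, y i = α + β * c i := fun i => by simp [hy]
  have hd : ∑ l, (y (l + 1) - y l) ^ 2 = β ^ 2 * ∑ l, (c (l + 1) - c l) ^ 2 := by
    rw [Finset.mul_sum]
    exact Finset.sum_congr rfl fun l _ => by rw [hyi, hyi]; ring
  have hs : ∑ l, y l ^ 2 = N * α ^ 2 + β ^ 2 * ∑ l, c l ^ 2 := by
    have : ∀ l, y l ^ 2 = α ^ 2 + 2 * α * β * c l + β ^ 2 * c l ^ 2 := fun l => by
      rw [hyi]; ring
    simp only [this, Finset.sum_add_distrib, ← Finset.mul_sum, hcs]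
    simp
  have hcpos : 1 ≤ ∑ l, c l ^ 2 := by
    have := Finset.single_le_sum (f := fun l => c l ^ 2) (fun i _ => sq_nonneg _)
      (Finset.mem_univ (0 : ZMod N))
    simpa [hc0] using this
  have hNpos : (0 : ℝ) < N := by exact_mod_cast (by omega : 0 < N)
  have hspos : 0 < ∑ l, y l ^ 2 := by
    rw [hs]
    rcases hne with h | h
    · have := sq_pos_of_ne_zero h
      have h2 := sq_nonneg β
      nlinarith [mul_pos hNpos this]
    · have := sq_pos_of_ne_zero h
      have h2 := mul_nonneg hNpos.le (sq_nonneg α)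
      nlinarith
  have hx : ∑ l, (3 * x l ^ 2 - 1) * y l ^ 2 ≤ (3 * B ^ 2 - 1) * ∑ l, y l ^ 2 := by
    rw [Finset.mul_sum]
    refine Finset.sum_le_sum fun l _ => ?_
    have := sq_le_sq' (neg_le_of_abs_le (hB l)) (le_of_abs_le (hB l))
    exact mul_le_mul_of_nonneg_right (by linarith) (sq_nonneg _)
  rw [hd, hcd] at hq
  set g := γ * (1 - Real.cos (2 * Real.pi / N)) with hg
  have hg0 : 0 ≤ g := mul_nonneg hγ.le (by linarith [Real.cos_le_one (2 * Real.pi / N)])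
  have h1 : γ / 2 * (β ^ 2 * (2 * (1 - Real.cos (2 * Real.pi / N)) * ∑ l, c l ^ 2))
      = g * (β ^ 2 * ∑ l, c l ^ 2) := by rw [hg]; ring
  have h2 : g * (β ^ 2 * ∑ l, c l ^ 2) ≤ g * ∑ l, y l ^ 2 := by
    refine mul_le_mul_of_nonneg_left ?_ hg0
    rw [hs]
    have := mul_nonneg hNpos.le (sq_nonneg α)
    linarith
  have h3 : 0 ≤ (3 * B ^ 2 - 1 + g) * ∑ l, y l ^ 2 := by linarith
  have := nonneg_of_mul_nonneg_left h3 hspos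
  linarith

open scoped ZMod ComplexConjugate in
theorem sum_norm_sq_dft {N : ℕ} [NeZero N] (Φ : ZMod N → ℂ) :
    ∑ k, ‖𝓕 Φ k‖ ^ 2 = N * ∑ j, ‖Φ j‖ ^ 2 := by
  have h : ∑ k, 𝓕 Φ k * conj (𝓕 Φ k) = N * ∑ j, Φ j * conj (Φ j) := by
    have h1 : ∀ k, conj (𝓕 Φ k) = ∑ j, ZMod.stdAddChar (-(k * -j)) * conj (Φ j) := by
      intro k
      rw [ZMod.dft_apply, map_sum]
      refine Finset.sum_congr rfl fun j _ => ?_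
      rw [smul_eq_mul, map_mul, ← AddChar.map_neg_eq_conj]
      congr 2
      ring
    simp only [h1, Finset.mul_sum]
    rw [Finset.sum_comm]
    refine Finset.sum_congr rfl fun j _ => ?_
    have h2 := congrFun (ZMod.dft_dft Φ) (-j)
    rw [ZMod.dft_apply] at h2
    simp only [smul_eq_mul, neg_neg] at h2
    rw [← mul_assoc, ← h2, Finset.sum_mul]
    exact Finset.sum_congr rfl fun k _ => by ring
  have h3 : ∀ z : ℂ, z * conj z = ((‖z‖ ^ 2 : ℝ) : ℂ) := fun z => by
    rw [Complex.mul_conj, Complex.normSq_eq_norm_sq]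
  simp only [h3] at h
  exact_mod_cast h

open scoped ZMod in
theorem dft_diff {N : ℕ} [NeZero N] (Φ : ZMod N → ℂ) (k : ZMod N) :
    𝓕 (fun i => Φ (i + 1) - Φ i) k = (ZMod.stdAddChar k - 1) * 𝓕 Φ k := by
  have h1 := Equiv.sum_comp (Equiv.addRight (1 : ZMod N))
    fun j => ZMod.stdAddChar (-((j - 1) * k)) * Φ j
  simp only [Equiv.coe_addRight, add_sub_cancel_right] at h1
  simp only [ZMod.dft_apply, smul_eq_mul, mul_sub, Finset.sum_sub_distrib, h1, sub_mul, one_mul,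
    Finset.mul_sum]
  congr 1
  refine Finset.sum_congr rfl fun j _ => ?_
  rw [← mul_assoc, ← AddChar.map_add_eq_mul]
  congr 2
  ring

theorem le_norm_stdAddChar_sub_one {N : ℕ} [NeZero N] {k : ZMod N} (hk : k ≠ 0) :
    2 * (1 - Real.cos (2 * Real.pi / N)) ≤ ‖ZMod.stdAddChar k - 1‖ ^ 2 := by
  have hN : (0 : ℝ) < N := Nat.cast_pos.mpr (Nat.pos_of_ne_zero (NeZero.ne N))
  have h1 : ZMod.stdAddChar k
      = Complex.exp (((2 * Real.pi * (k.val : ℝ) / N : ℝ) : ℂ) * Complex.I) := by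
    have := ZMod.stdAddChar_coe (N := N) (k.val : ℤ)
    rw [Int.cast_natCast, ZMod.natCast_zmod_val] at this
    rw [this]
    congr 1
    push_cast
    ring
  set t : ℝ := 2 * Real.pi * (k.val : ℝ) / N with ht
  have h2 : ‖ZMod.stdAddChar k - 1‖ ^ 2 = 2 * (1 - Real.cos t) := by
    rw [h1, Complex.exp_mul_I, ← Complex.ofReal_cos, ← Complex.ofReal_sin,
      ← Complex.normSq_eq_norm_sq, Complex.normSq_apply]
    simp only [Complex.sub_re, Complex.add_re, Complex.mul_re, Complex.sub_im, Complex.add_im,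
      Complex.mul_im, Complex.ofReal_re, Complex.ofReal_im, Complex.I_re, Complex.I_im,
      Complex.one_re, Complex.one_im]
    linear_combination Real.sin_sq_add_cos_sq t
  rw [h2]
  have hv1 : (1 : ℝ) ≤ k.val := by
    have : k.val ≠ 0 := by simpa [ZMod.val_eq_zero] using hk
    exact_mod_cast Nat.one_le_iff_ne_zero.mpr this
  have hv2 : (k.val : ℝ) + 1 ≤ N := by exact_mod_cast ZMod.val_lt k
  have hpi := Real.pi_pos
  have : Real.cos t ≤ Real.cos (2 * Real.pi / N) := by
    by_cases hle : t ≤ Real.pi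
    · apply Real.cos_le_cos_of_nonneg_of_le_pi (by positivity) hle
      rw [ht]
      exact div_le_div_of_nonneg_right (le_mul_of_one_le_right (by positivity) hv1) hN.le
    · rw [← Real.cos_two_pi_sub t]
      apply Real.cos_le_cos_of_nonneg_of_le_pi (by positivity) (by linarith)
      rw [ht, div_le_iff₀ hN, sub_mul, div_mul_cancel₀ _ hN.ne']
      nlinarith
  linarith

open scoped ZMod in
/-- The discrete Wirtinger inequality. -/
theorem discrete_wirtinger {N : ℕ} [NeZero N] (x : ZMod N → ℝ) :
    2 * (1 - Real.cos (2 * Real.pi / N)) * (∑ i, x i ^ 2 - (∑ i, x i) ^ 2 / N)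
      ≤ ∑ i, (x (i + 1) - x i) ^ 2 := by
  have hN : (0 : ℝ) < N := Nat.cast_pos.mpr (Nat.pos_of_ne_zero (NeZero.ne N))
  set Φ : ZMod N → ℂ := fun i => (x i : ℂ) with hΦ
  have h1 := sum_norm_sq_dft Φ
  have h2 := sum_norm_sq_dft fun i => Φ (i + 1) - Φ i
  have h3 : ∀ i, ‖Φ i‖ ^ 2 = x i ^ 2 := fun i => by simp [hΦ]
  have h4 : ∀ i, ‖Φ (i + 1) - Φ i‖ ^ 2 = (x (i + 1) - x i) ^ 2 := fun i => by
    rw [hΦ]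
    dsimp only
    rw [← Complex.ofReal_sub, Complex.norm_real, Real.norm_eq_abs, sq_abs]
  simp only [h3] at h1
  simp only [h4, dft_diff, norm_mul, mul_pow] at h2
  have h5 : ‖𝓕 Φ 0‖ ^ 2 = (∑ i, x i) ^ 2 := by
    rw [ZMod.dft_apply_zero, hΦ, ← Complex.ofReal_sum, Complex.norm_real, Real.norm_eq_abs, sq_abs]
  set lam := 2 * (1 - Real.cos (2 * Real.pi / N)) with hlam
  have h6 : lam * (∑ k, ‖𝓕 Φ k‖ ^ 2 - ‖𝓕 Φ 0‖ ^ 2)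
      ≤ ∑ k, ‖ZMod.stdAddChar k - 1‖ ^ 2 * ‖𝓕 Φ k‖ ^ 2 := by
    rw [← Finset.sum_erase_eq_sub (Finset.mem_univ (0 : ZMod N)), Finset.mul_sum,
      ← Finset.sum_erase_add _ _ (Finset.mem_univ (0 : ZMod N))]
    have : 0 ≤ ‖ZMod.stdAddChar (0 : ZMod N) - 1‖ ^ 2 * ‖𝓕 Φ 0‖ ^ 2 := by positivity
    refine le_add_of_le_of_nonneg (Finset.sum_le_sum fun k hk => ?_) this
    exact mul_le_mul_of_nonneg_right (le_norm_stdAddChar_sub_one (Finset.ne_of_mem_erase hk))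
      (sq_nonneg _)
  rw [h1, h2, h5] at h6
  have h7 : (N : ℝ) * (lam * (∑ i, x i ^ 2 - (∑ i, x i) ^ 2 / N))
      = lam * (N * ∑ i, x i ^ 2 - (∑ i, x i) ^ 2) := by
    field_simp
  exact le_of_mul_le_mul_left (by rw [h7]; exact h6) hN

/-- The energy balance satisfied by the stationary points of `V_γ`. -/
theorem stationary_balance {N : ℕ} [NeZero N] {γ : ℝ} {x : ZMod N → ℝ}
    (hx : fderiv ℝ (V N γ) x = 0) :
    ∑ i, x i ^ 4 = ∑ i, x i ^ 2 - γ / 2 * ∑ i, (x (i + 1) - x i) ^ 2 := by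
  have h := fderiv_V_apply N γ x x
  rw [hx] at h
  simp only [← sq, zero_apply] at h
  have h1 : ∀ i, (x i ^ 3 - x i) * x i = x i ^ 4 - x i ^ 2 := fun i => by ring
  simp only [h1, Finset.sum_sub_distrib] at h
  linarith

theorem V_stationary {N : ℕ} [NeZero N] {γ : ℝ} {x : ZMod N → ℝ}
    (hx : fderiv ℝ (V N γ) x = 0) : V N γ x = -(1 / 4) * ∑ i, x i ^ 4 := by
  have h := stationary_balance hx
  simp only [V, U, Finset.sum_sub_distrib, ← Finset.sum_div]
  linarith

theorem V_Iplus (N : ℕ) [NeZero N] (γ : ℝ) : V N γ (Iplus N) = -(N / 4) := by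
  simp [V, U, Iplus]
  ring

theorem sum_stationary {N : ℕ} [NeZero N] {γ : ℝ} {x : ZMod N → ℝ}
    (hx : fderiv ℝ (V N γ) x = 0) : ∑ i, x i = ∑ i, x i ^ 3 := by
  have h := fderiv_V_apply N γ x fun _ => 1
  rw [hx] at h
  simp only [zero_apply, mul_one, sub_self, mul_zero, Finset.sum_const_zero, add_zero,
    Finset.sum_sub_distrib] at h
  linarith

/-- Near the bifurcation at `γ₁`, stationary points away from `±1` are small. -/
theorem sum_pow_four_le {N : ℕ} [NeZero N] {γ ε : ℝ} {x : ZMod N → ℝ} (hγ : 0 < γ)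
    (hγ1 : γ * (1 - Real.cos (2 * Real.pi / N)) ≤ 1) (hx : fderiv ℝ (V N γ) x = 0)
    (hε : 0 < ε) (hxε : ∀ i, |x i| ≤ 1 - ε) :
    ∑ i, x i ^ 4 ≤ N * (1 - γ * (1 - Real.cos (2 * Real.pi / N))) ^ 2 / ε ^ 2 := by
  have hN : (0 : ℝ) < N := Nat.cast_pos.mpr (Nat.pos_of_ne_zero (NeZero.ne N))
  have hW := discrete_wirtinger x
  have hb := stationary_balance hx
  set g := γ * (1 - Real.cos (2 * Real.pi / N)) with hg
  have hg0 : 0 ≤ g := mul_nonneg hγ.le (by linarith [Real.cos_le_one (2 * Real.pi / N)])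
  set Q := ∑ i, x i ^ 2 with hQ
  set R := ∑ i, x i ^ 4 with hR
  have hQ0 : 0 ≤ Q := Finset.sum_nonneg fun i _ => sq_nonneg _
  have hR0 : 0 ≤ R := Finset.sum_nonneg fun i _ => by positivity
  have hcs : (∑ i, x i) ^ 2 ≤ Q * R := by
    rw [sum_stationary hx]
    have := Finset.sum_mul_sq_le_sq_mul_sq Finset.univ (fun i => x i) (fun i => x i ^ 2)
    have h1 : ∀ i, x i * x i ^ 2 = x i ^ 3 := fun i => by ring
    have h2 : ∀ i, (x i ^ 2) ^ 2 = x i ^ 4 := fun i => by ring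
    simpa only [h1, h2] using this
  have hcs2 : Q ^ 2 ≤ N * R := by
    have := Finset.sum_mul_sq_le_sq_mul_sq Finset.univ (fun _ : ZMod N => (1 : ℝ))
      (fun i => x i ^ 2)
    have h2 : ∀ i, (x i ^ 2) ^ 2 = x i ^ 4 := fun i => by ring
    simpa [h2] using this
  have hQε : Q ≤ N * (1 - ε) := by
    have h1 : ∀ i ∈ (Finset.univ : Finset (ZMod N)), x i ^ 2 ≤ 1 - ε := fun i _ => by
      have := abs_nonneg (x i)
      rw [← sq_abs]
      nlinarith [hxε i]
    have := Finset.sum_le_sum h1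
    rwa [Finset.sum_const, Finset.card_univ, ZMod.card, nsmul_eq_mul] at this
  have h1 : R ≤ (1 - g) * Q + g * ((∑ i, x i) ^ 2 / N) := by
    have h2 := mul_le_mul_of_nonneg_left hW (by positivity : 0 ≤ γ / 2)
    have h3 : γ / 2 * (2 * (1 - Real.cos (2 * Real.pi / N)) * (Q - (∑ i, x i) ^ 2 / N))
        = g * (Q - (∑ i, x i) ^ 2 / N) := by rw [hg]; ring
    rw [h3] at h2
    linarith
  have h2 : g * ((∑ i, x i) ^ 2 / N) ≤ (1 - ε) * R := by
    have h3 : (∑ i, x i) ^ 2 / N ≤ (1 - ε) * R := by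
      rw [div_le_iff₀ hN]
      nlinarith
    have h4 : 0 ≤ (∑ i, x i) ^ 2 / N := by positivity
    nlinarith
  have h3 : R * ε ≤ (1 - g) * Q := by linarith
  have h4 : (1 - g) * Q * ((1 - g) * Q) ≤ (1 - g) ^ 2 * (N * R) := by
    nlinarith [mul_le_mul_of_nonneg_left hcs2 (sq_nonneg (1 - g))]
  rw [le_div_iff₀ (by positivity)]
  rcases hR0.eq_or_lt with h | h
  · rw [← h]
    have := sq_nonneg (1 - g)
    nlinarith
  · have h5 : (R * ε) ^ 2 ≤ (1 - g) ^ 2 * (N * R) := by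
      have : 0 ≤ R * ε := by positivity
      nlinarith
    have h6 : R * (R * ε ^ 2) ≤ R * (N * (1 - g) ^ 2) := by linarith
    exact le_of_mul_le_mul_left h6 h

/-- The inverse phase speed `√((1+s)/(1-s sin² t))` along the periodic orbit of modulus `√s`
of the differential equation `u'' = u³ - u`. -/
noncomputable def invSpeed (s t : ℝ) : ℝ := √((1 + s) / (1 - s * Real.sin t ^ 2))

/-- The period of the orbit of modulus `√s`. -/
noncomputable def orbitPeriod (s : ℝ) : ℝ := 4 * ∫ t in (0:ℝ)..(Real.pi / 2), invSpeed s t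

/-- The density in phase of the integral of `u⁴` along the orbit of modulus `√s`. -/
noncomputable def quarticDensity (s t : ℝ) : ℝ :=
  (2 * s / (1 + s)) ^ 2 * Real.sin t ^ 4 * invSpeed s t

/-- The integral of `u⁴` over one period of the orbit of modulus `√s`. -/
noncomputable def orbitQuartic (s : ℝ) : ℝ := 4 * ∫ t in (0:ℝ)..(Real.pi / 2), quarticDensity s t

theorem one_sub_mul_sin_sq_pos {s : ℝ} (hs : 0 ≤ s) (hs1 : s < 1) (t : ℝ) :
    0 < 1 - s * Real.sin t ^ 2 := by
  have := Real.sin_sq_le_one t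
  nlinarith

theorem continuous_invSpeed {s : ℝ} (hs : 0 ≤ s) (hs1 : s < 1) : Continuous (invSpeed s) := by
  unfold invSpeed
  refine Real.continuous_sqrt.comp (Continuous.div continuous_const (by fun_prop) fun t => ?_)
  exact (one_sub_mul_sin_sq_pos hs hs1 t).ne'

theorem continuous_quarticDensity {s : ℝ} (hs : 0 ≤ s) (hs1 : s < 1) :
    Continuous (quarticDensity s) := by
  unfold quarticDensity
  have := continuous_invSpeed hs hs1
  fun_prop

theorem one_le_invSpeed {s : ℝ} (hs : 0 ≤ s) (hs1 : s < 1) (t : ℝ) : 1 ≤ invSpeed s t := by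
  have h := one_sub_mul_sin_sq_pos hs hs1 t
  rw [invSpeed, Real.one_le_sqrt, le_div_iff₀ h]
  nlinarith [sq_nonneg (Real.sin t)]

theorem invSpeed_sq {s : ℝ} (hs : 0 ≤ s) (hs1 : s < 1) (t : ℝ) :
    invSpeed s t ^ 2 = (1 + s) / (1 - s * Real.sin t ^ 2) := by
  have h := one_sub_mul_sin_sq_pos hs hs1 t
  rw [invSpeed, Real.sq_sqrt (by positivity)]

theorem invSpeed_sq_le {s : ℝ} (hs : 0 ≤ s) (hs1 : s < 1) (t : ℝ) :
    invSpeed s t ^ 2 ≤ (1 + s) / (1 - s) := by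
  rw [invSpeed_sq hs hs1]
  have := Real.sin_sq_le_one t
  have : 0 < 1 - s := by linarith
  gcongr
  nlinarith

theorem invSpeed_sub_ge {s r : ℝ} (hs : 0 ≤ s) (hsr : s ≤ r) (hr : r < 1) (t : ℝ) :
    (r - s) / 3 ≤ invSpeed r t - invSpeed s t := by
  have hs1 : s < 1 := by linarith
  have h1 := one_sub_mul_sin_sq_pos hs hs1 t
  have h2 := one_sub_mul_sin_sq_pos (hs.trans hsr) hr t
  have hq := Real.sin_sq_le_one t
  have hq0 := sq_nonneg (Real.sin t)
  have h3 : √(1 + r) / √(1 - s * Real.sin t ^ 2) ≤ invSpeed r t := by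
    rw [invSpeed, ← Real.sqrt_div (by linarith)]
    apply Real.sqrt_le_sqrt
    have : 0 ≤ 1 + r := by linarith
    gcongr
  have h4 : invSpeed s t = √(1 + s) / √(1 - s * Real.sin t ^ 2) := by
    rw [invSpeed, Real.sqrt_div (by linarith)]
  have h5 : √(1 - s * Real.sin t ^ 2) ≤ 1 := by
    rw [Real.sqrt_le_left zero_le_one]
    nlinarith
  have h6 : 0 < √(1 - s * Real.sin t ^ 2) := Real.sqrt_pos.mpr h1
  have h7 : √(1 + s) ≤ √(1 + r) := Real.sqrt_le_sqrt (by linarith)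
  have h8 : √(1 + r) - √(1 + s) ≤ (√(1 + r) - √(1 + s)) / √(1 - s * Real.sin t ^ 2) := by
    rw [le_div_iff₀ h6]
    nlinarith
  have h9 : (r - s) / 3 ≤ √(1 + r) - √(1 + s) := by
    have e1 := Real.sq_sqrt (by linarith : 0 ≤ 1 + r)
    have e2 := Real.sq_sqrt (by linarith : 0 ≤ 1 + s)
    have e3 : √(1 + r) ≤ 3 / 2 := by
      rw [Real.sqrt_le_left (by norm_num)]
      linarith
    have e4 : √(1 + s) ≤ 3 / 2 := h7.trans e3
    nlinarith
  rw [sub_div] at h8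
  linarith

theorem orbitPeriod_sub_ge {s r : ℝ} (hs : 0 ≤ s) (hsr : s ≤ r) (hr : r < 1) :
    2 * (r - s) ≤ orbitPeriod r - orbitPeriod s := by
  have hs1 : s < 1 := by linarith
  have hr0 : 0 ≤ r := by linarith
  have h1 := (continuous_invSpeed hs hs1).intervalIntegrable (μ := MeasureTheory.volume)
    0 (Real.pi / 2)
  have h2 := (continuous_invSpeed hr0 hr).intervalIntegrable (μ := MeasureTheory.volume)
    0 (Real.pi / 2)
  have h3 : ∫ t in (0:ℝ)..(Real.pi / 2), (r - s) / 3
      ≤ ∫ t in (0:ℝ)..(Real.pi / 2), (invSpeed r t - invSpeed s t) :=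
    intervalIntegral.integral_mono_on (by positivity) (by simp) (h2.sub h1)
      fun t _ => invSpeed_sub_ge hs hsr hr t
  rw [intervalIntegral.integral_sub h2 h1, intervalIntegral.integral_const, smul_eq_mul,
    sub_zero] at h3
  unfold orbitPeriod
  nlinarith [Real.pi_gt_three]

theorem orbitPeriod_zero : orbitPeriod 0 = 2 * Real.pi := by
  simp [orbitPeriod, invSpeed]
  ring

theorem orbitPeriod_ge {s : ℝ} (hs : 0 ≤ s) (hs1 : s < 1) :
    2 * Real.pi + 2 * s ≤ orbitPeriod s := by
  have := orbitPeriod_sub_ge le_rfl hs hs1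
  rw [orbitPeriod_zero] at this
  linarith

theorem orbitPeriod_sq_le {s : ℝ} (hs : 0 ≤ s) (hs1 : s < 1) :
    orbitPeriod s ^ 2 ≤ 4 * Real.pi ^ 2 * ((1 + s) / (1 - s)) := by
  have h1 := (continuous_invSpeed hs hs1).intervalIntegrable (μ := MeasureTheory.volume)
    0 (Real.pi / 2)
  have h0 : 0 < 1 - s := by linarith
  have h3 : ∫ t in (0:ℝ)..(Real.pi / 2), invSpeed s t
      ≤ ∫ t in (0:ℝ)..(Real.pi / 2), √((1 + s) / (1 - s)) :=
    intervalIntegral.integral_mono_on (by positivity) h1 (by simp)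
      fun t _ => Real.le_sqrt_of_sq_le (invSpeed_sq_le hs hs1 t)
  rw [intervalIntegral.integral_const, smul_eq_mul, sub_zero] at h3
  have h4 : orbitPeriod s ≤ 2 * Real.pi * √((1 + s) / (1 - s)) := by
    unfold orbitPeriod
    linarith
  have h5 : 0 ≤ orbitPeriod s := by
    have := orbitPeriod_ge hs hs1
    linarith [Real.pi_pos]
  have h6 := pow_le_pow_left₀ h5 h4 2
  rw [mul_pow, Real.sq_sqrt (by positivity)] at h6
  linarith

theorem quarticDensity_nonneg {s : ℝ} (t : ℝ) : 0 ≤ quarticDensity s t := by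
  unfold quarticDensity invSpeed
  positivity

theorem quarticDensity_le {s : ℝ} (hs : 0 ≤ s) (t : ℝ) :
    quarticDensity s t ≤ 4 * s ^ 2 * invSpeed s t := by
  unfold quarticDensity
  have h0 : 0 ≤ invSpeed s t := Real.sqrt_nonneg _
  have hq := Real.sin_sq_le_one t
  have hq0 := sq_nonneg (Real.sin t)
  have h1 : 2 * s / (1 + s) ≤ 2 * s := div_le_self (by linarith) (by linarith)
  have h2 : (2 * s / (1 + s)) ^ 2 ≤ (2 * s) ^ 2 := pow_le_pow_left₀ (by positivity) h1 2
  have h3 : Real.sin t ^ 4 ≤ 1 := by nlinarith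
  refine mul_le_mul_of_nonneg_right ?_ h0
  have h4 : 0 ≤ Real.sin t ^ 4 := by positivity
  nlinarith [sq_nonneg (2 * s)]

theorem orbitQuartic_nonneg {s : ℝ} : 0 ≤ orbitQuartic s := by
  unfold orbitQuartic
  have := intervalIntegral.integral_nonneg (μ := MeasureTheory.volume)
    (by positivity : 0 ≤ Real.pi / 2) fun t _ => quarticDensity_nonneg (s := s) t
  linarith

theorem orbitQuartic_le {s : ℝ} (hs : 0 ≤ s) (hs1 : s < 1) :
    orbitQuartic s ≤ 4 * s ^ 2 * orbitPeriod s := by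
  have h1 := (continuous_invSpeed hs hs1).intervalIntegrable (μ := MeasureTheory.volume)
    0 (Real.pi / 2)
  have h2 := (continuous_quarticDensity hs hs1).intervalIntegrable (μ := MeasureTheory.volume)
    0 (Real.pi / 2)
  have h3 := intervalIntegral.integral_mono_on (μ := MeasureTheory.volume)
    (by positivity : 0 ≤ Real.pi / 2) h2 (h1.const_mul (4 * s ^ 2))
      fun t _ => quarticDensity_le hs t
  rw [intervalIntegral.integral_const_mul] at h3
  unfold orbitQuartic orbitPeriod
  linarith

theorem abs_quarticDensity_sub_le {δ s r : ℝ} (hδ : 0 < δ) (hs : 0 ≤ s) (hr : 0 ≤ r)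
    (hs1 : s ≤ 1 - δ) (hr1 : r ≤ 1 - δ) (t : ℝ) :
    |quarticDensity s t - quarticDensity r t| ≤ 12 / δ ^ 2 * ((s + r) * |s - r|) := by
  have hs' : s < 1 := by linarith
  have hr' : r < 1 := by linarith
  have hδ1 : δ ≤ 1 := by linarith
  have hq := Real.sin_sq_le_one t
  have hq0 := sq_nonneg (Real.sin t)
  have hps := one_sub_mul_sin_sq_pos hs hs' t
  have hpr := one_sub_mul_sin_sq_pos hr hr' t
  set q := Real.sin t ^ 2 with hqdef
  have hps' : δ ≤ 1 - s * q := by nlinarith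
  have hpr' : δ ≤ 1 - r * q := by nlinarith
  have hBs := one_le_invSpeed hs hs' t
  have hBr := one_le_invSpeed hr hr' t
  have hBs2 := invSpeed_sq hs hs' t
  have hBr2 := invSpeed_sq hr hr' t
  rw [← hqdef] at hBs2 hBr2
  set B := invSpeed s t with hB
  set D := invSpeed r t with hD
  have hBle : B ≤ 2 / δ ^ 2 := by
    have : B ^ 2 ≤ 2 / δ ^ 2 := by
      rw [hBs2, div_le_div_iff₀ hps (by positivity)]
      nlinarith
    nlinarith
  have hBD : |B - D| ≤ 1 / δ ^ 2 * |s - r| := by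
    have h1 : (B - D) * (B + D) = (s - r) * ((1 + q) / ((1 - s * q) * (1 - r * q))) := by
      have : (B - D) * (B + D) = B ^ 2 - D ^ 2 := by ring
      have hps0 := hps.ne'
      have hpr0 := hpr.ne'
      rw [this, hBs2, hBr2, ← mul_div_assoc, div_sub_div _ _ hps0 hpr0]
      congr 1
      ring
    have h2 : |B - D| * (B + D) = |s - r| * ((1 + q) / ((1 - s * q) * (1 - r * q))) := by
      rw [← abs_of_nonneg (by linarith : 0 ≤ B + D), ← abs_mul, h1, abs_mul,
        abs_of_nonneg (a := (1 + q) / _) (by positivity)]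
    have h3 : (1 + q) / ((1 - s * q) * (1 - r * q)) ≤ 2 / δ ^ 2 := by
      rw [div_le_div_iff₀ (by positivity) (by positivity)]
      have : δ ^ 2 ≤ (1 - s * q) * (1 - r * q) := by nlinarith
      nlinarith [sq_nonneg δ]
    have h4 : |B - D| * 2 ≤ |s - r| * (2 / δ ^ 2) := by
      have := mul_le_mul_of_nonneg_left h3 (abs_nonneg (s - r))
      nlinarith [abs_nonneg (B - D)]
    have h5 : |s - r| * (2 / δ ^ 2) = 2 * (1 / δ ^ 2 * |s - r|) := by ring
    linarith
  have hA : |(2 * s / (1 + s)) ^ 2 - (2 * r / (1 + r)) ^ 2| ≤ 4 * ((s + r) * |s - r|) := by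
    have h1 : (2 * s / (1 + s)) ^ 2 - (2 * r / (1 + r)) ^ 2
        = (2 * s / (1 + s) + 2 * r / (1 + r)) * (2 / ((1 + s) * (1 + r))) * (s - r) := by
      field_simp
      ring
    rw [h1, abs_mul, abs_of_nonneg (by positivity)]
    have e1 : 2 * s / (1 + s) ≤ 2 * s := div_le_self (by linarith) (by linarith)
    have e2 : 2 * r / (1 + r) ≤ 2 * r := div_le_self (by linarith) (by linarith)
    have e3 : 2 / ((1 + s) * (1 + r)) ≤ 2 := div_le_self (by norm_num) (by nlinarith)
    have e4 : (2 * s / (1 + s) + 2 * r / (1 + r)) * (2 / ((1 + s) * (1 + r)))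
        ≤ (2 * s + 2 * r) * 2 := by gcongr
    calc _ ≤ (2 * s + 2 * r) * 2 * |s - r| := mul_le_mul_of_nonneg_right e4 (abs_nonneg _)
      _ = _ := by ring
  have hAr : (2 * r / (1 + r)) ^ 2 ≤ 4 * (s + r) := by
    have e2 : 2 * r / (1 + r) ≤ 2 * r := div_le_self (by linarith) (by linarith)
    have := pow_le_pow_left₀ (by positivity) e2 2
    nlinarith
  have hS : Real.sin t ^ 4 = q ^ 2 := by rw [hqdef]; ring
  have hq2 : q ^ 2 ≤ 1 := by nlinarith
  unfold quarticDensity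
  rw [← hB, ← hD, hS]
  have h1 : (2 * s / (1 + s)) ^ 2 * q ^ 2 * B - (2 * r / (1 + r)) ^ 2 * q ^ 2 * D
      = q ^ 2 * (((2 * s / (1 + s)) ^ 2 - (2 * r / (1 + r)) ^ 2) * B
        + (2 * r / (1 + r)) ^ 2 * (B - D)) := by ring
  rw [h1, abs_mul, abs_of_nonneg (sq_nonneg q)]
  have h2 : |((2 * s / (1 + s)) ^ 2 - (2 * r / (1 + r)) ^ 2) * B
        + (2 * r / (1 + r)) ^ 2 * (B - D)|
      ≤ 4 * ((s + r) * |s - r|) * (2 / δ ^ 2) + 4 * (s + r) * (1 / δ ^ 2 * |s - r|) := by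
    refine (abs_add_le _ _).trans ?_
    rw [abs_mul, abs_mul, abs_of_nonneg (by linarith : 0 ≤ B),
      abs_of_nonneg (sq_nonneg (2 * r / (1 + r)))]
    gcongr
  have h3 : 4 * ((s + r) * |s - r|) * (2 / δ ^ 2) + 4 * (s + r) * (1 / δ ^ 2 * |s - r|)
      = 12 / δ ^ 2 * ((s + r) * |s - r|) := by ring
  rw [h3] at h2
  exact (mul_le_of_le_one_left (abs_nonneg _) hq2).trans h2

theorem abs_orbitQuartic_sub_le {δ s r : ℝ} (hδ : 0 < δ) (hs : 0 ≤ s) (hr : 0 ≤ r)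
    (hs1 : s ≤ 1 - δ) (hr1 : r ≤ 1 - δ) :
    |orbitQuartic s - orbitQuartic r| ≤ 96 / δ ^ 2 * ((s + r) * |s - r|) := by
  have h1 := (continuous_quarticDensity hs (by linarith)).intervalIntegrable
    (μ := MeasureTheory.volume) 0 (Real.pi / 2)
  have h2 := (continuous_quarticDensity hr (by linarith)).intervalIntegrable
    (μ := MeasureTheory.volume) 0 (Real.pi / 2)
  have h3 := intervalIntegral.norm_integral_le_of_norm_le_const (a := 0) (b := Real.pi / 2)
    (f := fun t => quarticDensity s t - quarticDensity r t) fun t _ =>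
      abs_quarticDensity_sub_le hδ hs hr hs1 hr1 t
  rw [intervalIntegral.integral_sub h1 h2, Real.norm_eq_abs, sub_zero,
    abs_of_pos (by positivity : 0 < Real.pi / 2)] at h3
  unfold orbitQuartic
  rw [← mul_sub, abs_mul, abs_of_pos (by norm_num : (0:ℝ) < 4)]
  have h4 : 0 ≤ 12 / δ ^ 2 * ((s + r) * |s - r|) := by positivity
  have h5 : 96 / δ ^ 2 * ((s + r) * |s - r|) = 8 * (12 / δ ^ 2 * ((s + r) * |s - r|)) := by ring
  rw [h5]
  nlinarith [Real.pi_lt_four]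

theorem invSpeed_eq {s : ℝ} (hs : 0 ≤ s) (t : ℝ) :
    invSpeed s t = √(1 + s) * (1 / √(1 - s * Real.sin t ^ 2)) := by
  rw [invSpeed, Real.sqrt_div (by linarith)]
  ring

theorem orbitPeriod_eq {κ : ℝ} : orbitPeriod (κ ^ 2) = 4 * √(1 + κ ^ 2) * ellK κ := by
  unfold orbitPeriod ellK
  simp only [invSpeed_eq (sq_nonneg κ), intervalIntegral.integral_const_mul]
  ring

theorem integral_sin_pow_four_div {κ : ℝ} (h0 : 0 < κ) (h1 : κ < 1) :
    3 * κ ^ 4 * ∫ t in (0:ℝ)..(Real.pi / 2),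
        Real.sin t ^ 4 * (1 / √(1 - κ ^ 2 * Real.sin t ^ 2))
      = (2 + κ ^ 2) * ellK κ - 2 * (1 + κ ^ 2) * ellE κ := by
  have hs : κ ^ 2 < 1 := by nlinarith
  have hpos := one_sub_mul_sin_sq_pos (sq_nonneg κ) hs
  have hcK : Continuous fun t => 1 / √(1 - κ ^ 2 * Real.sin t ^ 2) :=
    continuous_const.div (by fun_prop) fun t => (Real.sqrt_pos.mpr (hpos t)).ne'
  have hcE : Continuous fun t => √(1 - κ ^ 2 * Real.sin t ^ 2) := by fun_prop
  have hcS : Continuous fun t => Real.sin t ^ 4 * (1 / √(1 - κ ^ 2 * Real.sin t ^ 2)) := by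
    fun_prop
  have hderiv : ∀ t : ℝ, HasDerivAt
      (fun t => κ ^ 2 * (Real.sin t * Real.cos t * √(1 - κ ^ 2 * Real.sin t ^ 2)))
      (3 * κ ^ 4 * (Real.sin t ^ 4 * (1 / √(1 - κ ^ 2 * Real.sin t ^ 2)))
        - (2 + κ ^ 2) * (1 / √(1 - κ ^ 2 * Real.sin t ^ 2))
        + 2 * (1 + κ ^ 2) * √(1 - κ ^ 2 * Real.sin t ^ 2)) t := by
    intro t
    have e1 := (((Real.hasDerivAt_sin t).pow 2).const_mul (κ ^ 2)).const_sub 1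
    have e2 := e1.sqrt (hpos t).ne'
    have e3 := (((Real.hasDerivAt_sin t).mul (Real.hasDerivAt_cos t)).mul e2).const_mul (κ ^ 2)
    refine e3.congr_deriv ?_
    have hΔ : √(1 - κ ^ 2 * Real.sin t ^ 2) ≠ 0 := (Real.sqrt_pos.mpr (hpos t)).ne'
    have hΔ2 := Real.sq_sqrt (hpos t).le
    simp only [Pi.mul_apply, Pi.pow_apply]
    generalize √(1 - κ ^ 2 * Real.sin t ^ 2) = Δ at *
    have hc : Real.cos t ^ 2 = 1 - Real.sin t ^ 2 := by linarith [Real.sin_sq_add_cos_sq t]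
    field_simp
    ring_nf
    simp only [hΔ2, hc]
    ring_nf
  have h := intervalIntegral.integral_eq_sub_of_hasDerivAt (a := 0) (b := Real.pi / 2)
    (fun t _ => hderiv t) (Continuous.intervalIntegrable (by fun_prop) _ _)
  have iK := hcK.intervalIntegrable (μ := MeasureTheory.volume) 0 (Real.pi / 2)
  have iE := hcE.intervalIntegrable (μ := MeasureTheory.volume) 0 (Real.pi / 2)
  have iS := hcS.intervalIntegrable (μ := MeasureTheory.volume) 0 (Real.pi / 2)
  rw [intervalIntegral.integral_add ((iS.const_mul _).sub (iK.const_mul _)) (iE.const_mul _),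
    intervalIntegral.integral_sub (iS.const_mul _) (iK.const_mul _)] at h
  simp only [intervalIntegral.integral_const_mul, Real.sin_pi_div_two, Real.cos_pi_div_two,
    Real.sin_zero, mul_zero, zero_mul, sub_zero] at h
  unfold ellK ellE
  linarith

theorem ellK_pos {κ : ℝ} (h0 : 0 < κ) (h1 : κ < 1) : 0 < ellK κ := by
  have hs : κ ^ 2 < 1 := by nlinarith
  have h := orbitPeriod_ge (sq_nonneg κ) hs
  rw [orbitPeriod_eq] at h
  have h2 : 0 < 4 * √(1 + κ ^ 2) * ellK κ := by
    have := Real.pi_pos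
    nlinarith [sq_nonneg κ]
  exact pos_of_mul_pos_right h2 (by positivity)

/-- The mean value of `u⁴` along an orbit in terms of the complete elliptic integrals. -/
theorem orbitQuartic_div_orbitPeriod {κ : ℝ} (h0 : 0 < κ) (h1 : κ < 1) :
    (1/(3*(1+κ^2))) * ((2+κ^2)/(1+κ^2) - 2 * ellE κ / ellK κ)
      = 1 / 4 * (orbitQuartic (κ ^ 2) / orbitPeriod (κ ^ 2)) := by
  have hK := ellK_pos h0 h1
  have hint := integral_sin_pow_four_div h0 h1
  have hJ : orbitQuartic (κ ^ 2) = 4 * ((2 * κ ^ 2 / (1 + κ ^ 2)) ^ 2 * √(1 + κ ^ 2)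
      * ∫ t in (0:ℝ)..(Real.pi / 2),
        Real.sin t ^ 4 * (1 / √(1 - κ ^ 2 * Real.sin t ^ 2))) := by
    have hfun : quarticDensity (κ ^ 2) = fun t => (2 * κ ^ 2 / (1 + κ ^ 2)) ^ 2 * √(1 + κ ^ 2)
        * (Real.sin t ^ 4 * (1 / √(1 - κ ^ 2 * Real.sin t ^ 2))) := by
      funext t
      simp only [quarticDensity, invSpeed_eq (sq_nonneg κ)]
      ring
    simp only [orbitQuartic, hfun, intervalIntegral.integral_const_mul]
  have hr : √(1 + κ ^ 2) ≠ 0 := (Real.sqrt_pos.mpr (by positivity)).ne'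
  rw [hJ, orbitPeriod_eq]
  set S := ∫ t in (0:ℝ)..(Real.pi / 2),
        Real.sin t ^ 4 * (1 / √(1 - κ ^ 2 * Real.sin t ^ 2))
  have hS : S = ((2 + κ ^ 2) * ellK κ - 2 * (1 + κ ^ 2) * ellE κ) / (3 * κ ^ 4) := by
    rw [← hint]
    field_simp
  rw [hS]
  field_simp
  ring

/-- `X` and its scaled increments `P` solve the symplectic Euler scheme with step `h` for the
equation `u'' = -f(u)`. -/
def IsEulerOrbit (h : ℝ) (X P : ℕ → ℝ) : Prop :=
  ∀ n, X (n + 1) = X n + h * P (n + 1) ∧ P (n + 1) = P n - h * fdrift (X n)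

theorem isEulerOrbit_of_equilibrium {N : ℕ} [NeZero N] {γ h : ℝ} {x : ZMod N → ℝ}
    (hh : 0 < h) (hhγ : h ^ 2 * γ = 2)
    (hx : ∀ i, γ / 2 * (2 * x i - x (i + 1) - x (i - 1)) = x i - x i ^ 3) (i : ZMod N) :
    IsEulerOrbit h (fun n => x (i + n)) fun n => (x (i + n) - x (i + n - 1)) / h := by
  intro n
  have e : i + ((n + 1 : ℕ) : ZMod N) = i + n + 1 := by push_cast; ring
  have e' : i + n + 1 - 1 = i + (n : ZMod N) := by ring
  simp only [e, e', fdrift]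
  have h1 := hx (i + n)
  constructor
  · field_simp
    ring
  · rw [div_eq_iff hh.ne', sub_mul, div_mul_cancel₀ _ hh.ne', ← h1]
    linear_combination (x (i + n + 1) + x (i + n - 1) - 2 * x (i + n)) * (1 / 2) * hhγ * (-1)

theorem abs_fdrift_sub_le {a b : ℝ} (ha : |a| ≤ 1) (hb : |b| ≤ 1) :
    |fdrift a - fdrift b| ≤ 2 * |a - b| := by
  rw [abs_le] at ha hb
  have h1 : fdrift a - fdrift b = (1 - (a ^ 2 + a * b + b ^ 2)) * (a - b) := by
    unfold fdrift
    ring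
  rw [h1, abs_mul]
  refine mul_le_mul_of_nonneg_right ?_ (abs_nonneg _)
  rw [abs_le]
  constructor <;> nlinarith [sq_nonneg (a + b), sq_nonneg (a - b), sq_nonneg a, sq_nonneg b]

theorem abs_fdrift_le {a : ℝ} (ha : |a| ≤ 1) : |fdrift a| ≤ |a| := by
  have h1 : fdrift a = (1 - a ^ 2) * a := by
    unfold fdrift
    ring
  have h2 : a ^ 2 ≤ 1 := (sq_le_one_iff_abs_le_one a).mpr ha
  rw [h1, abs_mul, abs_of_nonneg (by linarith : 0 ≤ 1 - a ^ 2)]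
  exact mul_le_of_le_one_left (abs_nonneg _) (by nlinarith [sq_nonneg a])

/-- Discrete Gronwall estimate for approximate solutions of the symplectic Euler scheme. -/
theorem IsEulerOrbit.gronwall {h B : ℝ} {X P Y W : ℕ → ℝ} (hO : IsEulerOrbit h X P) (h0 : 0 ≤ h)
    (h1 : h ≤ 1) (hB : 0 ≤ B) (hX : ∀ n, |X n| ≤ 1) (hY : ∀ n, |Y n| ≤ 1)
    (hYW : ∀ n, |Y (n + 1) - (Y n + h * (W n - h * fdrift (Y n)))| ≤ B * h ^ 2)
    (hW : ∀ n, |W (n + 1) - (W n - h * fdrift (Y n))| ≤ B * h ^ 2) (n : ℕ) :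
    |X n - Y n| + |P n - W n|
      ≤ Real.exp (4 * (n * h)) * (|X 0 - Y 0| + |P 0 - W 0| + 2 * B * (n * h ^ 2)) := by
  induction n with
  | zero => simp
  | succ n ih =>
    obtain ⟨e1, e2⟩ := hO n
    have hf := abs_fdrift_sub_le (hX n) (hY n)
    have b2 : |P (n + 1) - W (n + 1)|
        ≤ |P n - W n| + h * (2 * |X n - Y n|) + B * h ^ 2 := by
      have : P (n + 1) - W (n + 1) = (P n - W n) - h * (fdrift (X n) - fdrift (Y n))
          - (W (n + 1) - (W n - h * fdrift (Y n))) := by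
        rw [e2]
        ring
      rw [this]
      refine (abs_sub _ _).trans (add_le_add ((abs_sub _ _).trans ?_) (hW n))
      rw [abs_mul, abs_of_nonneg h0]
      gcongr
    have b1 : |X (n + 1) - Y (n + 1)|
        ≤ |X n - Y n| + h * (|P n - W n| + h * (2 * |X n - Y n|)) + B * h ^ 2 := by
      have : X (n + 1) - Y (n + 1)
          = (X n - Y n) + h * ((P n - W n) - h * (fdrift (X n) - fdrift (Y n)))
          - (Y (n + 1) - (Y n + h * (W n - h * fdrift (Y n)))) := by
        rw [e1, e2]
        ring
      rw [this]
      refine (abs_sub _ _).trans (add_le_add ((abs_add_le _ _).trans ?_) (hYW n))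
      rw [abs_mul, abs_of_nonneg h0]
      gcongr
      refine (abs_sub _ _).trans ?_
      rw [abs_mul, abs_of_nonneg h0]
      gcongr
    have a0 := abs_nonneg (X n - Y n)
    have p0 := abs_nonneg (P n - W n)
    set a := |X n - Y n|
    set p := |P n - W n|
    have b3 : |X (n + 1) - Y (n + 1)| + |P (n + 1) - W (n + 1)|
        ≤ (1 + 4 * h) * (a + p) + 2 * (B * h ^ 2) := by
      nlinarith [mul_nonneg h0 a0, mul_nonneg h0 p0,
        mul_nonneg (mul_nonneg h0 a0) (sub_nonneg.mpr h1)]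
    have hexp : 1 + 4 * h ≤ Real.exp (4 * h) := by linarith [Real.add_one_le_exp (4 * h)]
    have hn : Real.exp (4 * ((n + 1 : ℕ) * h)) = Real.exp (4 * h) * Real.exp (4 * (n * h)) := by
      rw [← Real.exp_add]
      congr 1
      push_cast
      ring
    have hone : 1 ≤ Real.exp (4 * ((n + 1 : ℕ) * h)) := Real.one_le_exp (by positivity)
    have b4 : (1 + 4 * h) * (a + p) ≤ Real.exp (4 * h) * (Real.exp (4 * (n * h))
        * (|X 0 - Y 0| + |P 0 - W 0| + 2 * B * (n * h ^ 2))) := by gcongr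
    have b5 : 2 * (B * h ^ 2) ≤ Real.exp (4 * ((n + 1 : ℕ) * h)) * (2 * (B * h ^ 2)) :=
      le_mul_of_one_le_left (by positivity) hone
    calc _ ≤ _ := b3
      _ ≤ _ := add_le_add b4 b5
      _ = _ := by
        rw [hn]
        push_cast
        ring

/-- At a maximum of an equilibrium the drift controls the incoming increment. -/
theorem increment_at_max {N : ℕ} [NeZero N] {γ h : ℝ} {x : ZMod N → ℝ} (hh : 0 < h)
    (hhγ : h ^ 2 * γ = 2)
    (hx : ∀ i, γ / 2 * (2 * x i - x (i + 1) - x (i - 1)) = x i - x i ^ 3) {i : ZMod N}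
    (hi : ∀ j, x j ≤ x i) :
    0 ≤ (x i - x (i - 1)) / h ∧ (x i - x (i - 1)) / h ≤ h * fdrift (x i) := by
  have h1 := hi (i - 1)
  have h2 := hi (i + 1)
  refine ⟨div_nonneg (by linarith) hh.le, ?_⟩
  rw [div_le_iff₀ hh, fdrift, ← hx i]
  nlinarith

theorem le_one_of_equilibrium {N : ℕ} [NeZero N] {γ h : ℝ} {x : ZMod N → ℝ} (hh : 0 < h)
    (hhγ : h ^ 2 * γ = 2)
    (hx : ∀ i, γ / 2 * (2 * x i - x (i + 1) - x (i - 1)) = x i - x i ^ 3) (j : ZMod N) :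
    x j ≤ 1 := by
  obtain ⟨i, hi⟩ := Finite.exists_max x
  obtain ⟨h1, h2⟩ := increment_at_max hh hhγ hx hi
  refine (hi j).trans ?_
  by_contra! hlt
  have h3 : fdrift (x i) < 0 := by
    unfold fdrift
    nlinarith [mul_pos (sub_pos.mpr hlt) (by linarith : 0 < x i)]
  nlinarith

theorem neg_equilibrium {N : ℕ} {γ : ℝ} {x : ZMod N → ℝ}
    (hx : ∀ i, γ / 2 * (2 * x i - x (i + 1) - x (i - 1)) = x i - x i ^ 3) :
    ∀ i, γ / 2 * (2 * (-x) i - (-x) (i + 1) - (-x) (i - 1)) = (-x) i - (-x) i ^ 3 := by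
  intro i
  simp only [Pi.neg_apply]
  linear_combination -hx i

theorem abs_le_one_of_equilibrium {N : ℕ} [NeZero N] {γ h : ℝ} {x : ZMod N → ℝ} (hh : 0 < h)
    (hhγ : h ^ 2 * γ = 2)
    (hx : ∀ i, γ / 2 * (2 * x i - x (i + 1) - x (i - 1)) = x i - x i ^ 3) (j : ZMod N) :
    |x j| ≤ 1 := by
  rw [abs_le]
  have h1 := le_one_of_equilibrium hh hhγ (neg_equilibrium hx) j
  rw [Pi.neg_apply] at h1
  exact ⟨by linarith, le_one_of_equilibrium hh hhγ hx j⟩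

/-- An equilibrium taking a nonpositive value stays uniformly away from `1`. -/
theorem le_one_sub_of_equilibrium {N : ℕ} [NeZero N] {γ h : ℝ} {x : ZMod N → ℝ}
    (hh : 0 < h) (hh1 : h ≤ 1) (hhγ : h ^ 2 * γ = 2) (hNh : N * h ≤ 13)
    (hx : ∀ i, γ / 2 * (2 * x i - x (i + 1) - x (i - 1)) = x i - x i ^ 3)
    (hneg : ∃ i, x i ≤ 0) (j : ZMod N) : x j ≤ 1 - Real.exp (-52) / 3 := by
  obtain ⟨i, hi⟩ := Finite.exists_max x
  obtain ⟨k, hk⟩ := hneg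
  refine (hi j).trans ?_
  have hb := abs_le_one_of_equilibrium hh hhγ hx
  have hO := isEulerOrbit_of_equilibrium hh hhγ hx i
  have hG := hO.gronwall (Y := fun _ => 1) (W := fun _ => 0) (B := 0) hh.le hh1 le_rfl
    (fun n => hb _) (by simp) (by simp [fdrift]) (by simp [fdrift]) (k - i).val
  have hki : i + (((k - i).val : ℕ) : ZMod N) = k := by
    rw [ZMod.natCast_zmod_val]
    ring
  obtain ⟨hp0, hp1⟩ := increment_at_max hh hhγ hx hi
  simp only [hki, Nat.cast_zero, add_zero, sub_zero, mul_zero, zero_mul] at hG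
  rw [abs_of_nonneg hp0] at hG
  by_contra! hlt
  have hxi := (abs_le.mp (hb i)).2
  rw [abs_of_nonpos (by linarith : x i - 1 ≤ 0)] at hG
  have hexp0 := Real.exp_pos (-52)
  have hexp1 : Real.exp (-52) ≤ 1 := Real.exp_le_one_iff.mpr (by norm_num)
  have hf : fdrift (x i) ≤ 2 * (1 - x i) := by
    unfold fdrift
    nlinarith [mul_nonneg (sub_nonneg.mpr hxi) (sq_nonneg (x i)), mul_nonneg (sub_nonneg.mpr hxi)
      (sub_nonneg.mpr hxi)]
  have hp2 : (x i - x (i - 1)) / h ≤ 2 * (1 - x i) := by nlinarith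
  have hv : (((k - i).val : ℕ) : ℝ) ≤ N := by exact_mod_cast (ZMod.val_lt _).le
  have he : Real.exp (4 * (((k - i).val : ℕ) * h)) ≤ Real.exp 52 := by
    apply Real.exp_le_exp.mpr
    nlinarith
  have h1 : 1 ≤ |x k - 1| := by
    rw [abs_of_nonpos (by linarith)]
    linarith
  have h2 := abs_nonneg ((x k - x (k - 1)) / h)
  have h3 : 1 ≤ Real.exp 52 * (3 * (1 - x i)) := by
    refine (by linarith : (1:ℝ) ≤ _).trans (hG.trans ?_)
    apply mul_le_mul he (by linarith) (by linarith) (Real.exp_pos _).le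
  have h4 : Real.exp 52 * Real.exp (-52) = 1 := by
    rw [← Real.exp_add]
    simp
  nlinarith [Real.exp_pos 52]

/-- If an equilibrium has constant sign, then it is `±(1,…,1)` and its Hessian is nonnegative. -/
theorem exists_nonpos_of_quadratic_neg {N : ℕ} [NeZero N] {γ : ℝ} {x : ZMod N → ℝ} (hγ : 0 < γ)
    (hsum : ∑ i, x i = ∑ i, x i ^ 3) (hb : ∀ i, |x i| ≤ 1)
    (hneg : ∃ y : ZMod N → ℝ, (∑ l, (3 * x l ^ 2 - 1) * y l ^ 2)
      + γ / 2 * ∑ l, (y (l + 1) - y l) ^ 2 < 0) : ∃ i, x i ≤ 0 := by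
  by_contra! hpos
  obtain ⟨y, hy⟩ := hneg
  have h0 : ∀ i ∈ Finset.univ, 0 ≤ x i - x i ^ 3 := fun i _ => by
    have h1 := (sq_le_one_iff_abs_le_one (x i)).mpr (hb i)
    nlinarith [hpos i, mul_nonneg (hpos i).le (sub_nonneg.mpr h1)]
  have h1 := (Finset.sum_eq_zero_iff_of_nonneg h0).mp
    (by rw [Finset.sum_sub_distrib, hsum, sub_self])
  have h2 : ∀ i, x i ^ 2 = 1 := fun i => by
    have := h1 i (Finset.mem_univ i)
    have h3 : x i * (1 - x i ^ 2) = 0 := by linarith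
    rcases mul_eq_zero.mp h3 with h | h
    · linarith [hpos i]
    · linarith
  have h3 : 0 ≤ ∑ l, (3 * x l ^ 2 - 1) * y l ^ 2 := Finset.sum_nonneg fun l _ => by
    rw [h2]
    nlinarith [sq_nonneg (y l)]
  have h4 : 0 ≤ ∑ l, (y (l + 1) - y l) ^ 2 := Finset.sum_nonneg fun l _ => sq_nonneg _
  nlinarith

theorem abs_le_of_index_one {N : ℕ} [NeZero N] {γ h : ℝ} {x : ZMod N → ℝ} (hγ : 0 < γ)
    (hh : 0 < h) (hh1 : h ≤ 1) (hhγ : h ^ 2 * γ = 2) (hNh : N * h ≤ 13)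
    (hx : fderiv ℝ (V N γ) x = 0) (hind : negCount (hess N γ x) = 1) (j : ZMod N) :
    |x j| ≤ 1 - Real.exp (-52) / 3 := by
  have hst := fun i => stationary_eq hx i
  have hb := abs_le_one_of_equilibrium hh hhγ hst
  obtain ⟨y, hy⟩ := exists_quadratic_neg (hess_isHermitian N γ x) hind
  rw [hess_quadratic] at hy
  have hsum := sum_stationary hx
  have h1 := exists_nonpos_of_quadratic_neg hγ hsum hb ⟨y, hy⟩
  have h2 := exists_nonpos_of_quadratic_neg (x := -x) hγ
    (by simp only [Pi.neg_apply, Odd.neg_pow (by decide : Odd 3), Finset.sum_neg_distrib, hsum])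
    (by simpa using hb) ⟨y, by simpa using hy⟩
  have h3 := le_one_sub_of_equilibrium hh hh1 hhγ hNh hst h1 j
  have h4 := le_one_sub_of_equilibrium hh hh1 hhγ hNh (neg_equilibrium hst) h2 j
  rw [Pi.neg_apply] at h4
  exact abs_le.mpr ⟨by linarith, h3⟩

theorem abs_taylor_le {g G G' : ℝ → ℝ} {C : ℝ} (hg : ∀ t, HasDerivAt g (G t) t)
    (hG : ∀ t, HasDerivAt G (G' t) t) (hC : ∀ t, |G' t| ≤ C) (t : ℝ) {h : ℝ} (h0 : 0 ≤ h) :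
    |g (t + h) - (g t + h * G t)| ≤ C * h ^ 2 := by
  have hC0 : 0 ≤ C := (abs_nonneg _).trans (hC t)
  have hLip : ∀ b, |G b - G t| ≤ C * |b - t| := fun b =>
    Convex.norm_image_sub_le_of_norm_hasDerivWithin_le (s := Set.univ)
      (fun x _ => (hG x).hasDerivWithinAt) (fun x _ => hC x) convex_univ (Set.mem_univ _)
      (Set.mem_univ _)
  have hψ : ∀ x, HasDerivAt (fun τ => g τ - τ * G t) (G x - G t) x := fun x =>
    ((hg x).sub ((hasDerivAt_id x).mul_const (G t))).congr_deriv (by rw [one_mul])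
  have h1 := Convex.norm_image_sub_le_of_norm_hasDerivWithin_le (s := Set.Icc t (t + h))
    (f := fun τ => g τ - τ * G t) (C := C * h)
    (fun x _ => (hψ x).hasDerivWithinAt) (fun x hx => by
      refine (hLip x).trans (mul_le_mul_of_nonneg_left ?_ hC0)
      rw [abs_of_nonneg (by linarith [hx.1])]
      linarith [hx.2]) (convex_Icc _ _) (Set.left_mem_Icc.mpr (by linarith))
    (Set.right_mem_Icc.mpr (by linarith))
  rw [Real.norm_eq_abs, Real.norm_eq_abs, add_sub_cancel_left, abs_of_nonneg h0] at h1
  calc _ = |g (t + h) - (t + h) * G t - (g t - t * G t)| := by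
        congr 1
        ring
    _ ≤ _ := h1
    _ = _ := by ring

/-- The phase of the periodic orbit of modulus `√s` as a function of time. -/
theorem exists_phase {s : ℝ} (hs : 0 ≤ s) (hs1 : s < 1) :
    ∃ φ : ℝ → ℝ, φ 0 = Real.pi / 2 ∧
      (∀ t, ∫ τ in (Real.pi / 2)..(φ t), invSpeed s τ = t) ∧
      ∀ t, HasDerivAt φ (invSpeed s (φ t))⁻¹ t := by
  have hc := continuous_invSpeed hs hs1
  have hF : ∀ y, HasDerivAt (fun y => ∫ τ in (Real.pi / 2)..y, invSpeed s τ) (invSpeed s y) y :=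
    fun y => hc.integral_hasStrictDerivAt _ y |>.hasDerivAt
  set F : ℝ → ℝ := fun y => ∫ τ in (Real.pi / 2)..y, invSpeed s τ with hFdef
  have hpos : ∀ y, 0 < invSpeed s y := fun y => zero_lt_one.trans_le (one_le_invSpeed hs hs1 y)
  have hmono : StrictMono F := strictMono_of_hasDerivAt_pos hF hpos
  have hmono' : Monotone fun y => F y - y := by
    have hd : ∀ y, HasDerivAt (fun y => F y - y) (invSpeed s y - 1) y := fun y =>
      (hF y).sub (hasDerivAt_id y)
    refine monotone_of_deriv_nonneg (fun y => (hd y).differentiableAt) fun y => ?_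
    rw [(hd y).deriv]
    linarith [one_le_invSpeed hs hs1 y]
  have hcont : Continuous F := continuous_iff_continuousAt.mpr fun y => (hF y).continuousAt
  have hsurj : Function.Surjective F := by
    refine hcont.surjective ?_ ?_
    · refine Filter.tendsto_atTop_mono' _ ?_
        (Filter.tendsto_atTop_add_const_right _ (F 0) Filter.tendsto_id)
      filter_upwards [Filter.eventually_ge_atTop 0] with y hy
      have := hmono' hy
      simp only [sub_zero] at this
      simp only [id]
      linarith
    · refine Filter.tendsto_atBot_mono' _ ?_
        (Filter.tendsto_atBot_add_const_right _ (F 0) Filter.tendsto_id)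
      filter_upwards [Filter.eventually_le_atBot 0] with y hy
      have := hmono' hy
      simp only [sub_zero] at this
      simp only [id]
      linarith
  let e : ℝ ≃o ℝ := hmono.orderIsoOfSurjective F hsurj
  have he : ∀ t, F (e.symm t) = t := fun t => e.apply_symm_apply t
  refine ⟨e.symm, ?_, he, fun t => ?_⟩
  · apply hmono.injective
    rw [he]
    simp [hFdef]
  · exact HasDerivAt.of_local_left_inverse e.symm.continuous.continuousAt (hF _) (hpos _).ne'
      (Filter.Eventually.of_forall he)

theorem inv_invSpeed (s t : ℝ) :
    (invSpeed s t)⁻¹ = √((1 - s * Real.sin t ^ 2) / (1 + s)) := by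
  rw [invSpeed, ← Real.sqrt_inv, inv_div]

theorem hasDerivAt_inv_invSpeed {s : ℝ} (hs : 0 ≤ s) (hs1 : s < 1) (t : ℝ) :
    HasDerivAt (fun t => (invSpeed s t)⁻¹)
      (-(s * Real.sin t * Real.cos t / (1 + s)) * invSpeed s t) t := by
  have hpos := one_sub_mul_sin_sq_pos hs hs1 t
  have h1 : (1 - s * Real.sin t ^ 2) / (1 + s) ≠ 0 := (div_pos hpos (by linarith)).ne'
  have e1 := (((((Real.hasDerivAt_sin t).pow 2).const_mul s).const_sub 1).div_const (1 + s)).sqrt h1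
  simp only [inv_invSpeed]
  refine e1.congr_deriv ?_
  simp only [Pi.pow_apply]
  rw [← inv_invSpeed]
  have hI : invSpeed s t ≠ 0 := (zero_lt_one.trans_le (one_le_invSpeed hs hs1 t)).ne'
  have : 1 + s ≠ 0 := by linarith
  field_simp
  ring

/-- The velocity of the orbit with amplitude `M` and phase `φ`. -/
theorem hasDerivAt_velocity {s M : ℝ} {φ : ℝ → ℝ} (hs : 0 ≤ s) (hs1 : s < 1)
    (hM : M ^ 2 * (1 + s) = 2 * s) (hφ : ∀ t, HasDerivAt φ (invSpeed s (φ t))⁻¹ t) (t : ℝ) :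
    HasDerivAt (fun t => M * Real.cos (φ t) * (invSpeed s (φ t))⁻¹)
      (-fdrift (M * Real.sin (φ t))) t := by
  have e1 := ((hφ t).cos.const_mul M).mul ((hasDerivAt_inv_invSpeed hs hs1 (φ t)).comp t (hφ t))
  refine e1.congr_deriv ?_
  have hpos := one_sub_mul_sin_sq_pos hs hs1 (φ t)
  have hI : invSpeed s (φ t) ≠ 0 := (zero_lt_one.trans_le (one_le_invSpeed hs hs1 (φ t))).ne'
  have hI2 := invSpeed_sq hs hs1 (φ t)
  have hs2 : 1 + s ≠ 0 := by linarith
  have hinv : (invSpeed s (φ t))⁻¹ ^ 2 = (1 - s * Real.sin (φ t) ^ 2) / (1 + s) := by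
    rw [inv_pow, hI2, inv_div]
  have hcos : Real.cos (φ t) ^ 2 = 1 - Real.sin (φ t) ^ 2 := by
    linarith [Real.sin_sq_add_cos_sq (φ t)]
  simp only [Function.comp_apply, fdrift]
  have h3 : M * (-Real.sin (φ t) * (invSpeed s (φ t))⁻¹) * (invSpeed s (φ t))⁻¹
      + M * Real.cos (φ t) * (-(s * Real.sin (φ t) * Real.cos (φ t) / (1 + s))
        * invSpeed s (φ t) * (invSpeed s (φ t))⁻¹)
      = -(M * Real.sin (φ t)) * (invSpeed s (φ t))⁻¹ ^ 2
        - M * Real.sin (φ t) * (s / (1 + s)) * Real.cos (φ t) ^ 2 := by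
    rw [mul_assoc _ (invSpeed s (φ t)), mul_inv_cancel₀ hI]
    ring
  rw [h3, hinv, hcos]
  have h4 : s / (1 + s) = M ^ 2 / 2 := by
    rw [div_eq_div_iff hs2 two_ne_zero]
    linarith
  have h5 : (1 - s * Real.sin (φ t) ^ 2) / (1 + s)
      = 1 - s / (1 + s) * (1 + Real.sin (φ t) ^ 2) := by
    field_simp
    ring
  rw [h5, h4]
  ring

theorem exists_near_max {θ a b : ℝ} (ha : 1 - Real.sin θ ≤ a) (hb : |Real.cos θ| ≤ b) :
    ∃ m : ℤ, |θ - (Real.pi / 2 + m * (2 * Real.pi))| ≤ 4 * a + 2 * b := by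
  have hπ := Real.pi_pos
  have hb0 := (abs_nonneg _).trans hb
  have ha0 : 0 ≤ a := by linarith [Real.sin_le_one θ]
  refine ⟨round ((θ - Real.pi / 2) / (2 * Real.pi)), ?_⟩
  set m : ℤ := round ((θ - Real.pi / 2) / (2 * Real.pi)) with hm
  set ψ := θ - (Real.pi / 2 + m * (2 * Real.pi)) with hψ
  have hψle : |ψ| ≤ Real.pi := by
    have h1 := abs_sub_round ((θ - Real.pi / 2) / (2 * Real.pi))
    rw [← hm] at h1
    have h2 : ψ = ((θ - Real.pi / 2) / (2 * Real.pi) - m) * (2 * Real.pi) := by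
      rw [hψ]
      field_simp
      ring
    rw [h2, abs_mul, abs_of_pos (by positivity : 0 < 2 * Real.pi)]
    nlinarith
  have hθ : θ = ψ + Real.pi / 2 + m * (2 * Real.pi) := by
    rw [hψ]
    ring
  have hsin : Real.sin θ = Real.cos ψ := by
    rw [hθ, Real.sin_add_int_mul_two_pi, Real.sin_add_pi_div_two]
  have hcos : Real.cos θ = -Real.sin ψ := by
    rw [hθ, Real.cos_add_int_mul_two_pi, Real.cos_add_pi_div_two]
  rcases le_or_gt |ψ| (Real.pi / 2) with h | h
  · have h1 := Real.mul_abs_le_abs_sin h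
    rw [hcos, abs_neg] at hb
    rw [div_mul_eq_mul_div, div_le_iff₀ hπ] at h1
    nlinarith [Real.pi_lt_four]
  · have h1 : Real.cos ψ ≤ 0 := by
      rw [← Real.cos_abs]
      exact Real.cos_nonpos_of_pi_div_two_le_of_le h.le (by linarith)
    rw [hsin] at ha
    linarith [Real.pi_lt_four]

theorem integral_int_periods {g : ℝ → ℝ} (hg : Continuous g)
    (hper : Function.Periodic g Real.pi) (hsym : ∀ t, g (Real.pi - t) = g t) (m : ℤ) :
    ∫ t in (Real.pi / 2)..(Real.pi / 2 + m * (2 * Real.pi)), g t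
      = m * (4 * ∫ t in (0:ℝ)..(Real.pi / 2), g t) := by
  have hi : ∀ a b, IntervalIntegrable g MeasureTheory.volume a b := hg.intervalIntegrable
  have h1 := hper.intervalIntegral_add_zsmul_eq (m * 2) (Real.pi / 2) hi
  have h2 := hper.intervalIntegral_add_eq (Real.pi / 2) 0
  have h3 : ∫ t in (Real.pi / 2)..Real.pi, g t = ∫ t in (0:ℝ)..(Real.pi / 2), g t := by
    have := intervalIntegral.integral_comp_sub_left (a := 0) (b := Real.pi / 2) g Real.pi
    simp only [hsym, sub_zero] at this
    rw [this]
    congr 1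
    ring
  have h4 := intervalIntegral.integral_add_adjacent_intervals (hi 0 (Real.pi / 2))
    (hi (Real.pi / 2) Real.pi)
  rw [h2, zero_add, ← h4, h3] at h1
  simp only [zsmul_eq_mul, Int.cast_mul, Int.cast_ofNat] at h1
  rw [← mul_assoc (m : ℝ) 2 Real.pi, h1]
  ring

theorem abs_integral_sub_periods_le {g : ℝ → ℝ} {D : ℝ} (hg : Continuous g)
    (hper : Function.Periodic g Real.pi) (hsym : ∀ t, g (Real.pi - t) = g t)
    (hD : ∀ t, |g t| ≤ D) (θ : ℝ) (m : ℤ) :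
    |(∫ t in (Real.pi / 2)..θ, g t) - m * (4 * ∫ t in (0:ℝ)..(Real.pi / 2), g t)|
      ≤ D * |θ - (Real.pi / 2 + m * (2 * Real.pi))| := by
  have hi : ∀ a b, IntervalIntegrable g MeasureTheory.volume a b := hg.intervalIntegrable
  rw [← integral_int_periods hg hper hsym m,
    intervalIntegral.integral_interval_sub_left (hi _ _) (hi _ _)]
  exact intervalIntegral.norm_integral_le_of_norm_le_const (f := g) fun t _ => hD t

theorem invSpeed_le {ε s : ℝ} (hε : 0 < ε) (hs : 0 ≤ s) (hs1 : s ≤ 1 - ε) (t : ℝ) :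
    invSpeed s t ≤ 2 / ε := by
  have h1 := one_le_invSpeed hs (by linarith) t
  have h2 := invSpeed_sq_le hs (by linarith) t
  have h3 : (1 + s) / (1 - s) ≤ 2 / ε := by
    rw [div_le_div_iff₀ (by linarith) hε]
    nlinarith
  nlinarith

theorem periodic_invSpeed (s : ℝ) : Function.Periodic (invSpeed s) Real.pi := fun t => by
  simp [invSpeed, Real.sin_add_pi]

theorem invSpeed_pi_sub (s t : ℝ) : invSpeed s (Real.pi - t) = invSpeed s t := by
  simp [invSpeed, Real.sin_pi_sub]

theorem periodic_quarticDensity (s : ℝ) : Function.Periodic (quarticDensity s) Real.pi :=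
  fun t => by
    simp [quarticDensity, periodic_invSpeed s t, Real.sin_add_pi, Even.neg_pow (by decide : Even 4)]

theorem quarticDensity_pi_sub (s t : ℝ) : quarticDensity s (Real.pi - t) = quarticDensity s t := by
  simp [quarticDensity, invSpeed_pi_sub, Real.sin_pi_sub]

theorem abs_amplitude_mul_sin_le {M θ : ℝ} (hM0 : 0 ≤ M) : |M * Real.sin θ| ≤ M := by
  rw [abs_mul, abs_of_nonneg hM0]
  exact mul_le_of_le_one_right hM0 (Real.abs_sin_le_one θ)

theorem abs_velocity_le {s M θ : ℝ} (hs : 0 ≤ s) (hs1 : s < 1) (hM0 : 0 ≤ M) :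
    |M * Real.cos θ * (invSpeed s θ)⁻¹| ≤ M := by
  have h1 := one_le_invSpeed hs hs1 θ
  have h2 : (invSpeed s θ)⁻¹ ≤ 1 := inv_le_one_of_one_le₀ h1
  have h3 : 0 ≤ (invSpeed s θ)⁻¹ := by positivity
  rw [mul_assoc, abs_mul, abs_mul, abs_of_nonneg hM0, abs_of_nonneg h3]
  exact mul_le_of_le_one_right hM0 (mul_le_one₀ (Real.abs_cos_le_one θ) h3 h2)

theorem hasDerivAt_position {s M : ℝ} {φ : ℝ → ℝ}
    (hφ : ∀ t, HasDerivAt φ (invSpeed s (φ t))⁻¹ t) (t : ℝ) :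
    HasDerivAt (fun t => M * Real.sin (φ t)) (M * Real.cos (φ t) * (invSpeed s (φ t))⁻¹) t :=
  ((hφ t).sin.const_mul M).congr_deriv (by ring)

theorem abs_le_of_amplitude {M a : ℝ} (hM1 : M ≤ 1) (ha : |a| ≤ M) : a ^ 2 ≤ 1 := by
  rw [sq_le_one_iff_abs_le_one]
  linarith

/-- An Euler orbit starting at a maximum of height `M` stays close to the periodic orbit of
amplitude `M`. -/
theorem IsEulerOrbit.phase_approx {h s M : ℝ} {X P : ℕ → ℝ} {N : ℕ} {φ : ℝ → ℝ}
    (hO : IsEulerOrbit h X P) (h0 : 0 < h) (h1 : h ≤ 1) (hNh : N * h ≤ 13) (hs : 0 ≤ s)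
    (hs1 : s < 1) (hM0 : 0 ≤ M) (hM1 : M ≤ 1) (hM : M ^ 2 * (1 + s) = 2 * s)
    (hX : ∀ n, |X n| ≤ 1) (hX0 : X 0 = M) (hP0 : |P 0| ≤ h * M) (hφ0 : φ 0 = Real.pi / 2)
    (hφ : ∀ t, HasDerivAt φ (invSpeed s (φ t))⁻¹ t) {n : ℕ} (hn : n ≤ N) :
    |X n - M * Real.sin (φ (n * h))|
      + |P n - M * Real.cos (φ (n * h)) * (invSpeed s (φ (n * h)))⁻¹|
      ≤ Real.exp 52 * (53 * (h * M)) := by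
  have hu := fun t => hasDerivAt_position (M := M) hφ t
  have hv := fun t => hasDerivAt_velocity hs hs1 hM hφ t
  have bu : ∀ t, |M * Real.sin (φ t)| ≤ M := fun t => abs_amplitude_mul_sin_le hM0
  have bv : ∀ t, |M * Real.cos (φ t) * (invSpeed s (φ t))⁻¹| ≤ M := fun t =>
    abs_velocity_le hs hs1 hM0
  have bf : ∀ t, |fdrift (M * Real.sin (φ t))| ≤ M := fun t =>
    (abs_fdrift_le ((bu t).trans hM1)).trans (bu t)
  have hv' : ∀ t, HasDerivAt (fun t => -fdrift (M * Real.sin (φ t)))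
      (-((1 - 3 * (M * Real.sin (φ t)) ^ 2)
        * (M * Real.cos (φ t) * (invSpeed s (φ t))⁻¹))) t := fun t => by
    refine ((hu t).sub ((hu t).pow 3)).neg.congr_deriv ?_
    ring
  have bv' : ∀ t, |-((1 - 3 * (M * Real.sin (φ t)) ^ 2)
        * (M * Real.cos (φ t) * (invSpeed s (φ t))⁻¹))| ≤ 2 * M := fun t => by
    rw [abs_neg, abs_mul]
    refine mul_le_mul ?_ (bv t) (abs_nonneg _) zero_le_two
    have := abs_le_of_amplitude hM1 (bu t)
    rw [abs_le]
    constructor <;> nlinarith [sq_nonneg (M * Real.sin (φ t))]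
  have hstep : ∀ n : ℕ, ((n + 1 : ℕ) : ℝ) * h = n * h + h := fun n => by
    push_cast
    ring
  have hG := hO.gronwall (Y := fun n => M * Real.sin (φ (n * h)))
    (W := fun n => M * Real.cos (φ (n * h)) * (invSpeed s (φ (n * h)))⁻¹) (B := 2 * M) h0.le h1
    (by positivity) hX (fun n => (bu _).trans hM1)
    (fun n => by
      have t1 := abs_taylor_le hu hv (C := M) (fun t => by rw [abs_neg]; exact bf t) (n * h) h0.le
      have t2 : |h * (h * fdrift (M * Real.sin (φ (n * h))))| ≤ M * h ^ 2 := by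
        rw [abs_mul, abs_mul, abs_of_pos h0]
        calc _ ≤ h * (h * M) := by gcongr; exact bf _
          _ = _ := by ring
      simp only [hstep]
      set a := M * Real.sin (φ (n * h + h))
      set b := M * Real.sin (φ (n * h))
      set c := M * Real.cos (φ (n * h)) * (invSpeed s (φ (n * h)))⁻¹
      have e : a - (b + h * (c - h * fdrift b)) = (a - (b + h * c)) + h * (h * fdrift b) := by ring
      rw [e]
      refine (abs_add_le _ _).trans ?_
      linarith)
    (fun n => by
      have t1 := abs_taylor_le hv hv' bv' (n * h) h0.le
      simp only [hstep]
      rwa [mul_neg, ← sub_eq_add_neg] at t1) n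
  simp only [Nat.cast_zero, zero_mul, hφ0, Real.sin_pi_div_two, Real.cos_pi_div_two, mul_one,
    mul_zero, hX0, sub_self, abs_zero, zero_add, sub_zero] at hG
  have hn' : (n : ℝ) * h ≤ 13 :=
    (mul_le_mul_of_nonneg_right (Nat.cast_le.mpr hn) h0.le).trans hNh
  refine hG.trans (mul_le_mul (Real.exp_le_exp.mpr (by linarith)) ?_ (by positivity)
    (Real.exp_pos _).le)
  have : 2 * (2 * M) * (n * h ^ 2) = 4 * (n * h) * (h * M) := by ring
  nlinarith [mul_nonneg h0.le hM0]

theorem abs_riemann_sum_sub_le {Z g g' : ℝ → ℝ} {C h : ℝ} (hZ : ∀ t, HasDerivAt Z (g t) t)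
    (hg : ∀ t, HasDerivAt g (g' t) t) (hC : ∀ t, |g' t| ≤ C) (h0 : 0 ≤ h) (N : ℕ) :
    |h * ∑ n ∈ Finset.range N, g (n * h) - (Z (N * h) - Z 0)| ≤ N * (C * h ^ 2) := by
  have h1 := Finset.sum_range_sub (fun n : ℕ => Z (n * h)) N
  simp only [Nat.cast_zero, zero_mul] at h1
  rw [← h1, Finset.mul_sum, ← Finset.sum_sub_distrib]
  refine (Finset.abs_sum_le_sum_abs _ _).trans ?_
  calc _ ≤ ∑ n ∈ Finset.range N, C * h ^ 2 := Finset.sum_le_sum fun n _ => by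
        have := abs_taylor_le hZ hg hC (n * h) h0
        rw [abs_sub_comm]
        have e : ((n + 1 : ℕ) : ℝ) * h = n * h + h := by
          push_cast
          ring
        rwa [e, sub_sub]
    _ = _ := by simp

theorem abs_pow_four_sub_le {a b D : ℝ} (ha : |a| ≤ D) (hb : |b| ≤ D) :
    |a ^ 4 - b ^ 4| ≤ 4 * D ^ 3 * |a - b| := by
  have e : a ^ 4 - b ^ 4 = (a ^ 3 + a ^ 2 * b + a * b ^ 2 + b ^ 3) * (a - b) := by ring
  rw [e, abs_mul]
  refine mul_le_mul_of_nonneg_right ?_ (abs_nonneg _)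
  have h1 : |a ^ 3 + a ^ 2 * b + a * b ^ 2 + b ^ 3|
      ≤ |a| ^ 3 + |a| ^ 2 * |b| + |a| * |b| ^ 2 + |b| ^ 3 := by
    simp only [← abs_pow, ← abs_mul]
    refine (abs_add_le _ _).trans (add_le_add_left ?_ _)
    exact abs_add_three _ _ _
  have h2 : |a| ^ 3 + |a| ^ 2 * |b| + |a| * |b| ^ 2 + |b| ^ 3
      ≤ D ^ 3 + D ^ 2 * D + D * D ^ 2 + D ^ 3 := by
    have := (abs_nonneg a).trans ha
    gcongr
  linarith

/-- The integral of `u⁴` along the orbit of amplitude `M`, as a function of time. -/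
theorem hasDerivAt_quartic {s M : ℝ} {φ : ℝ → ℝ} (hs : 0 ≤ s) (hs1 : s < 1)
    (hM : M ^ 2 * (1 + s) = 2 * s) (hφ : ∀ t, HasDerivAt φ (invSpeed s (φ t))⁻¹ t) (t : ℝ) :
    HasDerivAt (fun t => ∫ τ in (Real.pi / 2)..(φ t), quarticDensity s τ)
      ((M * Real.sin (φ t)) ^ 4) t := by
  have e1 := ((continuous_quarticDensity hs hs1).integral_hasStrictDerivAt (Real.pi / 2)
    (φ t)).hasDerivAt.comp t (hφ t)
  refine e1.congr_deriv ?_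
  have hI : invSpeed s (φ t) ≠ 0 := (zero_lt_one.trans_le (one_le_invSpeed hs hs1 (φ t))).ne'
  have hs2 : 1 + s ≠ 0 := by linarith
  have h1 : 2 * s / (1 + s) = M ^ 2 := by
    rw [div_eq_iff hs2]
    linarith
  rw [quarticDensity, h1, mul_assoc _ (invSpeed s (φ t)), mul_inv_cancel₀ hI]
  ring

theorem IsEulerOrbit.quartic_approx {C h s M : ℝ} {X : ℕ → ℝ} {N : ℕ} {φ : ℝ → ℝ} (hC : 0 ≤ C)
    (h0 : 0 < h) (h1 : h ≤ 1) (hNh : N * h ≤ 13) (hs : 0 ≤ s)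
    (hs1 : s < 1) (hM0 : 0 ≤ M) (hM : M ^ 2 * (1 + s) = 2 * s)
    (hX : ∀ n ≤ N, |X n - M * Real.sin (φ (n * h))| ≤ C * (h * M)) (hφ0 : φ 0 = Real.pi / 2)
    (hφ : ∀ t, HasDerivAt φ (invSpeed s (φ t))⁻¹ t) :
    |h * ∑ n ∈ Finset.range N, X n ^ 4
      - ∫ τ in (Real.pi / 2)..(φ (N * h)), quarticDensity s τ|
      ≤ (208 * (1 + C) ^ 3 * C + 208) * (h * s ^ 2) := by
  have hu := fun t => hasDerivAt_position (M := M) hφ t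
  have bu : ∀ t, |M * Real.sin (φ t)| ≤ M := fun t => abs_amplitude_mul_sin_le hM0
  have bv : ∀ t, |M * Real.cos (φ t) * (invSpeed s (φ t))⁻¹| ≤ M := fun t =>
    abs_velocity_le hs hs1 hM0
  have hM2 : M ^ 2 ≤ 2 * s := by nlinarith [sq_nonneg M]
  have hM4 : M ^ 4 ≤ 4 * s ^ 2 := by nlinarith [sq_nonneg M]
  have hR := abs_riemann_sum_sub_le (hasDerivAt_quartic hs hs1 hM hφ) (fun t => (hu t).pow 4)
    (C := 4 * M ^ 4) (fun t => by
      have := pow_le_pow_left₀ (abs_nonneg _) (bu t) 3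
      have h4 : |M * Real.sin (φ t)| ^ 3 * |M * Real.cos (φ t) * (invSpeed s (φ t))⁻¹|
          ≤ M ^ 3 * M := mul_le_mul this (bv t) (abs_nonneg _) (by positivity)
      change |((4 : ℕ) : ℝ) * (M * Real.sin (φ t)) ^ 3
        * (M * Real.cos (φ t) * (invSpeed s (φ t))⁻¹)| ≤ 4 * M ^ 4
      rw [abs_mul, abs_mul, abs_pow, Nat.cast_ofNat, abs_of_pos four_pos]
      linarith) h0.le N
  simp only [hφ0, intervalIntegral.integral_same, sub_zero] at hR
  have hS : |h * ∑ n ∈ Finset.range N, X n ^ 4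
      - h * ∑ n ∈ Finset.range N, (M * Real.sin (φ (n * h))) ^ 4|
      ≤ h * (N * (4 * ((1 + C) * M) ^ 3 * (C * (h * M)))) := by
    rw [← mul_sub, abs_mul, abs_of_pos h0, ← Finset.sum_sub_distrib]
    refine mul_le_mul_of_nonneg_left ((Finset.abs_sum_le_sum_abs _ _).trans ?_) h0.le
    calc _ ≤ ∑ n ∈ Finset.range N, 4 * ((1 + C) * M) ^ 3 * (C * (h * M)) :=
          Finset.sum_le_sum fun n hn => by
            have hn' := hX n (Finset.mem_range.mp hn).le
            have b1 : |M * Real.sin (φ (n * h))| ≤ (1 + C) * M := by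
              have := bu (n * h)
              nlinarith [mul_nonneg hC hM0]
            have b2 : |X n| ≤ (1 + C) * M := by
              have e : X n = (X n - M * Real.sin (φ (n * h))) + M * Real.sin (φ (n * h)) := by ring
              rw [e]
              refine (abs_add_le _ _).trans ?_
              have := bu (n * h)
              nlinarith [mul_nonneg (mul_nonneg hC hM0) (sub_nonneg.mpr h1)]
            refine (abs_pow_four_sub_le b2 b1).trans ?_
            gcongr
      _ = _ := by simp
  have e1 : h * (N * (4 * ((1 + C) * M) ^ 3 * (C * (h * M))))
      = (N * h) * (4 * (1 + C) ^ 3 * C * h * M ^ 4) := by ring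
  have e2 : N * (4 * M ^ 4 * h ^ 2) = (N * h) * (4 * h * M ^ 4) := by ring
  rw [e1] at hS
  rw [e2] at hR
  have b1 : (N * h) * (4 * (1 + C) ^ 3 * C * h * M ^ 4)
      ≤ 13 * (4 * (1 + C) ^ 3 * C * h * (4 * s ^ 2)) := by gcongr
  have b2 : (N * h) * (4 * h * M ^ 4) ≤ 13 * (4 * h * (4 * s ^ 2)) := by gcongr
  refine (abs_sub_le _ (h * ∑ n ∈ Finset.range N, (M * Real.sin (φ (n * h))) ^ 4) _).trans ?_
  refine (add_le_add (hS.trans b1) (hR.trans b2)).trans (le_of_eq ?_)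
  ring

/-- A periodic Euler orbit of amplitude `M` closes up after an integer number of periods of the
continuous orbit of the same amplitude, up to an error of the order of the step. -/
theorem IsEulerOrbit.exists_period_count {ε : ℝ} (hε : 0 < ε) :
    ∃ C : ℝ, 0 < C ∧ ∀ {h s M : ℝ} {X P : ℕ → ℝ} {N : ℕ}, IsEulerOrbit h X P → 0 < h → h ≤ 1 →
      N * h ≤ 13 → 0 ≤ s → s ≤ 1 - ε → 0 < M → M ≤ 1 → M ^ 2 * (1 + s) = 2 * s →
      (∀ n, |X n| ≤ 1) → X 0 = M → |P 0| ≤ h * M → X N = M → P N = P 0 →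
      (∀ n ≤ N, |X n| ≤ C * M) ∧ ∃ m : ℤ, |N * h - m * orbitPeriod s| ≤ C * h ∧
        |h * ∑ n ∈ Finset.range N, X n ^ 4 - m * orbitQuartic s| ≤ C * (h * s ^ 2) := by
  set K : ℝ := Real.exp 52 * 53 with hK
  have hK0 : 0 < K := by positivity
  set L : ℝ := 4 * K + 2 * ((K + 1) * (2 / ε)) with hL
  have hL0 : 0 < L := by positivity
  refine ⟨(1 + K) + 2 / ε * L + (4 * (2 / ε) * L + (208 * (1 + K) ^ 3 * K + 208)),
    by positivity, ?_⟩
  intro h s M X P N hO h0 h1 hNh hs hsε hM0 hM1 hM hX hX0 hP0 hXN hPN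
  have hs1 : s < 1 := by linarith
  obtain ⟨φ, hφ0, hφF, hφ⟩ := exists_phase hs hs1
  have hA := fun n (hn : n ≤ N) =>
    hO.phase_approx h0 h1 hNh hs hs1 hM0.le hM1 hM hX hX0 hP0 hφ0 hφ hn
  simp only [← mul_assoc, ← hK] at hA
  simp only [mul_assoc K] at hA
  have hAX : ∀ n ≤ N, |X n - M * Real.sin (φ (n * h))| ≤ K * (h * M) := fun n hn => by
    linarith [hA n hn, abs_nonneg (P n - M * Real.cos (φ (n * h)) * (invSpeed s (φ (n * h)))⁻¹)]
  have hAP := hA N le_rfl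
  have hAN := hAX N le_rfl
  set θ := φ (N * h) with hθ
  have hsin : 1 - Real.sin θ ≤ K * h := by
    rw [hXN] at hAN
    have h2 := le_of_abs_le hAN
    have h3 : M * (1 - Real.sin θ) ≤ M * (K * h) := by linarith
    exact le_of_mul_le_mul_left h3 hM0
  have hIpos : 0 < invSpeed s θ := zero_lt_one.trans_le (one_le_invSpeed hs hs1 θ)
  have hcos : |Real.cos θ| ≤ (K + 1) * h * (2 / ε) := by
    have h2 : |M * Real.cos θ * (invSpeed s θ)⁻¹| ≤ M * ((K + 1) * h) := by
      have e : M * Real.cos θ * (invSpeed s θ)⁻¹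
          = P N - (P N - M * Real.cos θ * (invSpeed s θ)⁻¹) := by ring
      rw [e]
      refine (abs_sub _ _).trans ?_
      rw [hPN] at hAP ⊢
      linarith [abs_nonneg (X N - M * Real.sin θ)]
    rw [abs_mul, abs_mul, abs_of_pos hM0, abs_of_pos (inv_pos.mpr hIpos), mul_assoc] at h2
    have h3 := le_of_mul_le_mul_left h2 hM0
    rw [← div_eq_mul_inv, div_le_iff₀ hIpos] at h3
    refine h3.trans ?_
    gcongr
    exact invSpeed_le hε hs hsε θ
  obtain ⟨m, hm⟩ := exists_near_max hsin hcos
  have hm' : |θ - (Real.pi / 2 + m * (2 * Real.pi))| ≤ L * h := by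
    rw [hL]
    linarith
  have hIb : ∀ t, |invSpeed s t| ≤ 2 / ε := fun t => by
    rw [abs_of_nonneg (zero_le_one.trans (one_le_invSpeed hs hs1 t))]
    exact invSpeed_le hε hs hsε t
  have hQb : ∀ t, |quarticDensity s t| ≤ 4 * s ^ 2 * (2 / ε) := fun t => by
    rw [abs_of_nonneg (quarticDensity_nonneg t)]
    refine (quarticDensity_le hs t).trans ?_
    gcongr
    exact invSpeed_le hε hs hsε t
  have hT := abs_integral_sub_periods_le (continuous_invSpeed hs hs1) (periodic_invSpeed s)
    (invSpeed_pi_sub s) hIb θ m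
  have hJ := abs_integral_sub_periods_le (continuous_quarticDensity hs hs1)
    (periodic_quarticDensity s) (quarticDensity_pi_sub s) hQb θ m
  rw [hθ, hφF, ← hθ] at hT
  have hQ := IsEulerOrbit.quartic_approx hK0.le h0 h1 hNh hs hs1 hM0.le hM hAX hφ0 hφ
  have hT' := hT.trans (mul_le_mul_of_nonneg_left hm' (by positivity : 0 ≤ 2 / ε))
  have hJ' := hJ.trans (mul_le_mul_of_nonneg_left hm' (by positivity : 0 ≤ 4 * s ^ 2 * (2 / ε)))
  have hε2 : 0 < 2 / ε := by positivity
  refine ⟨fun n hn => ?_, m, ?_, ?_⟩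
  · have h2 := hAX n hn
    have h3 : |M * Real.sin (φ (n * h))| ≤ M := abs_amplitude_mul_sin_le hM0.le
    have e : X n = (X n - M * Real.sin (φ (n * h))) + M * Real.sin (φ (n * h)) := by ring
    have h4 : |X n| ≤ (1 + K) * M := by
      rw [e]
      refine (abs_add_le _ _).trans ?_
      nlinarith [mul_nonneg (mul_nonneg hK0.le hM0.le) (sub_nonneg.mpr h1)]
    refine h4.trans (mul_le_mul_of_nonneg_right ?_ hM0.le)
    rw [add_assoc]
    exact le_add_of_nonneg_right (by positivity)
  · refine hT'.trans ?_
    rw [← mul_assoc]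
    refine mul_le_mul_of_nonneg_right ?_ h0.le
    have : 0 ≤ (1 + K) + (4 * (2 / ε) * L + (208 * (1 + K) ^ 3 * K + 208)) := by positivity
    linarith
  · refine (abs_sub_le _ _ _).trans ((add_le_add hQ hJ').trans ?_)
    have e : (208 * (1 + K) ^ 3 * K + 208) * (h * s ^ 2) + 4 * s ^ 2 * (2 / ε) * (L * h)
        = (4 * (2 / ε) * L + (208 * (1 + K) ^ 3 * K + 208)) * (h * s ^ 2) := by ring
    rw [e]
    refine mul_le_mul_of_nonneg_right ?_ (by positivity)
    exact le_add_of_nonneg_left (by positivity)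

theorem sum_range_shift {N : ℕ} [NeZero N] (f : ZMod N → ℝ) (i : ZMod N) :
    ∑ n ∈ Finset.range N, f (i + n) = ∑ j, f j := by
  rw [← Equiv.sum_comp (Equiv.addLeft i) f]
  refine Finset.sum_nbij' (fun n => (n : ZMod N)) ZMod.val (fun _ _ => Finset.mem_univ _)
    (fun j _ => Finset.mem_range.mpr (ZMod.val_lt j))
    (fun n hn => ZMod.val_cast_of_lt (Finset.mem_range.mp hn))
    (fun j _ => ZMod.natCast_zmod_val j) fun n _ => rfl

theorem period_sub_le {n T h a : ℝ} (hn : 0 < n) (ha0 : 0 < a) (ha1 : a ≤ 1) (hah : a ≤ h)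
    (hT0 : 0 ≤ T) (hT : T ≤ 16) (hna : n * a = Real.pi) (hhT : h * Real.pi = T * Real.sin a) :
    T - n * h ≤ 3 * h := by
  have hsin := (Real.sin_gt_sub_cube ha0).le
  have e1 : (T - n * h) * Real.pi = T * n * (a - Real.sin a) := by
    linear_combination -n * hhT - T * hna
  have e2 : (T - n * h) * Real.pi ≤ T * n * (a ^ 3 / 6) := by
    rw [e1]
    exact mul_le_mul_of_nonneg_left (by linarith) (by positivity)
  have e3 : T * n * (a ^ 3 / 6) = T * a ^ 2 / 6 * Real.pi := by
    rw [← hna]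
    ring
  rw [e3] at e2
  have e4 := le_of_mul_le_mul_right e2 Real.pi_pos
  have e5 : T * a ^ 2 ≤ 16 * a := mul_le_mul hT (by nlinarith) (sq_nonneg a) (by norm_num)
  linarith

/-- The mesh size and the modulus are related through the period of the continuous orbit. -/
theorem exists_step {N : ℕ} {γ κ : ℝ} (hN : 8 ≤ N) (hγ : 0 < γ) (hγ2 : gammaM N 2 < γ)
    (hγ1 : γ < gammaM N 1) (hκ0 : 0 < κ) (hκ1 : κ < 1)
    (heq : γ / gammaM N 1 = Real.pi ^ 2 / (4 * ellK κ ^ 2 * (1 + κ ^ 2))) :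
    ∃ h : ℝ, 0 < h ∧ h ^ 2 * γ = 2 ∧ 4 ≤ N * h ∧ N * h ≤ 4 * Real.pi ∧
      γ * (1 - Real.cos (2 * Real.pi / N)) < 1 ∧
      γ * (1 - Real.cos (2 * Real.pi / N)) * orbitPeriod (κ ^ 2) ^ 2 = 4 * Real.pi ^ 2 ∧
      N * h ≤ orbitPeriod (κ ^ 2) ∧ orbitPeriod (κ ^ 2) - N * h ≤ 3 * h := by
  have hπ := Real.pi_pos
  have hN8 : (8 : ℝ) ≤ N := by exact_mod_cast hN
  have hN0 : (0 : ℝ) < N := by linarith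
  set a : ℝ := Real.pi / N with ha
  have ha0 : 0 < a := by positivity
  have haN : N * a = Real.pi := by
    rw [ha]
    field_simp
  have ha1 : a ≤ Real.pi / 8 := by
    rw [ha]
    gcongr
  have hsa : 0 < Real.sin a := Real.sin_pos_of_pos_of_lt_pi ha0 (by linarith)
  have hs2a : 0 < Real.sin (2 * a) := Real.sin_pos_of_pos_of_lt_pi (by linarith) (by linarith)
  have hg1 : gammaM N 1 = (2 * Real.sin a ^ 2)⁻¹ := by
    have : 2 * Real.pi * ((1 : ℕ) : ℝ) / N = 2 * a := by
      rw [ha]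
      push_cast
      ring
    rw [gammaM, this, Real.cos_two_mul, Real.cos_sq']
    ring_nf
  have hg2 : gammaM N 2 = (2 * Real.sin (2 * a) ^ 2)⁻¹ := by
    have : 2 * Real.pi * ((2 : ℕ) : ℝ) / N = 2 * (2 * a) := by
      rw [ha]
      push_cast
      ring
    rw [gammaM, this, Real.cos_two_mul, Real.cos_sq']
    ring_nf
  have hcos : 1 - Real.cos (2 * Real.pi / N) = 2 * Real.sin a ^ 2 := by
    have : 2 * Real.pi / N = 2 * a := by
      rw [ha]
      ring
    rw [this, Real.cos_two_mul, Real.cos_sq']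
    ring
  rw [hg1] at hγ1 heq
  rw [hg2] at hγ2
  rw [div_inv_eq_mul] at heq
  rw [← one_div, lt_div_iff₀ (by positivity)] at hγ1
  rw [← one_div, div_lt_iff₀ (by positivity)] at hγ2
  have hh0 : 0 < √(2 / γ) := Real.sqrt_pos.mpr (by positivity)
  have hhγ : √(2 / γ) ^ 2 * γ = 2 := by
    rw [Real.sq_sqrt (by positivity)]
    field_simp
  set h := √(2 / γ) with hh
  have hlow : 2 * Real.sin a < h := by
    refine lt_of_pow_lt_pow_left₀ 2 hh0.le (lt_of_mul_lt_mul_right ?_ hγ.le)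
    linarith
  have hupp : h < 2 * Real.sin (2 * a) := by
    refine lt_of_pow_lt_pow_left₀ 2 (by positivity) (lt_of_mul_lt_mul_right ?_ hγ.le)
    linarith
  have hs2le : Real.sin (2 * a) ≤ 2 * Real.sin a := by
    rw [Real.sin_two_mul]
    nlinarith [Real.cos_le_one a]
  set T := orbitPeriod (κ ^ 2) with hT
  have hκ2 : κ ^ 2 < 1 := by nlinarith
  have hT0 : 0 < T := by
    have := orbitPeriod_ge (sq_nonneg κ) hκ2
    nlinarith [sq_nonneg κ]
  have hK := ellK_pos hκ0 hκ1
  have hgT : γ * (2 * Real.sin a ^ 2) * T ^ 2 = 4 * Real.pi ^ 2 := by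
    rw [heq, hT, orbitPeriod_eq, mul_pow, mul_pow, Real.sq_sqrt (by positivity)]
    field_simp
  have hhT : h * Real.pi = T * Real.sin a := by
    refine (pow_left_inj₀ (by positivity) (by positivity) two_ne_zero).mp ?_
    refine mul_right_cancel₀ hγ.ne' ?_
    linear_combination Real.pi ^ 2 * hhγ - hgT / 2
  have hsinle : Real.sin a ≤ a := (Real.sin_lt ha0).le
  have hsin2 : 2 / Real.pi * a ≤ Real.sin a := Real.mul_le_sin ha0.le (by linarith)
  have hNs : 2 ≤ N * Real.sin a := by
    calc (2:ℝ) = N * (2 / Real.pi * a) := by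
          rw [ha]
          field_simp
      _ ≤ _ := by gcongr
  have hNh4 : 4 ≤ N * h := by nlinarith
  have hNhT : N * h ≤ T := by
    refine le_of_mul_le_mul_right ?_ hπ
    calc N * h * Real.pi = T * (N * Real.sin a) := by rw [mul_assoc, hhT]; ring
      _ ≤ T * (N * a) := by gcongr
      _ = _ := by rw [haN]
  have hTπ : T ≤ 4 * Real.pi := by
    have h1 : T * Real.sin a ≤ 4 * Real.pi * Real.sin a := by
      rw [← hhT]
      nlinarith
    exact le_of_mul_le_mul_right h1 hsa
  refine ⟨h, hh0, hhγ, hNh4, ?_, by rwa [hcos], by rwa [hcos], hNhT, ?_⟩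
  · exact hNhT.trans hTπ
  · have h1 : N * a ≤ N * h := by linarith [Real.pi_lt_four]
    exact period_sub_le hN0 ha0 (by linarith [Real.pi_lt_four])
      (le_of_mul_le_mul_left h1 hN0) hT0.le (by linarith [Real.pi_lt_four]) haN hhT

/-- Comparison of a saddle of index one with a periodic orbit of the limiting equation. -/
theorem exists_orbit_of_saddle :
    ∃ C : ℝ, 0 < C ∧ ∀ {N : ℕ} [NeZero N] {γ h : ℝ} {x : ZMod N → ℝ}, 2 ≤ N → 0 < γ → 0 < h →
      h ≤ 1 → h ^ 2 * γ = 2 → N * h ≤ 13 → γ * (1 - Real.cos (2 * Real.pi / N)) < 1 →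
      fderiv ℝ (V N γ) x = 0 → negCount (hess N γ x) = 1 →
      ∃ s : ℝ, 0 ≤ s ∧ s ≤ 1 - Real.exp (-52) / 3 ∧
        1 - γ * (1 - Real.cos (2 * Real.pi / N)) ≤ C * s ∧
        ∃ m : ℤ, |N * h - m * orbitPeriod s| ≤ C * h ∧
          |h * ∑ i, x i ^ 4 - m * orbitQuartic s| ≤ C * (h * s ^ 2) := by
  have hε0 : 0 < Real.exp (-52) / 3 := by positivity
  have hε1 : Real.exp (-52) / 3 ≤ 1 := by
    have : Real.exp (-52) ≤ 1 := Real.exp_le_one_iff.mpr (by norm_num)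
    linarith
  obtain ⟨C, hC0, hC⟩ := IsEulerOrbit.exists_period_count hε0
  refine ⟨C + 6 * C ^ 2, by positivity, ?_⟩
  intro N _ γ h x hN hγ hh hh1 hhγ hNh hg hx hind
  have hst := fun i => stationary_eq hx i
  have hb := abs_le_of_index_one hγ hh hh1 hhγ hNh hx hind
  set ε := Real.exp (-52) / 3 with hε
  obtain ⟨i, hi⟩ := Finite.exists_max x
  set M := x i with hMdef
  have hM0 : 0 < M := by
    by_contra! hM
    have hsum := sum_stationary hx
    have hlt : ∀ j, x j ^ 2 < 1 := fun j =>
      (sq_lt_one_iff_abs_lt_one (x j)).mpr (by linarith [hb j])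
    have hnn : ∀ j ∈ Finset.univ, 0 ≤ x j ^ 3 - x j := fun j _ => by
      have h1 := mul_nonneg (by linarith [hi j] : 0 ≤ -x j) (sub_nonneg.mpr (hlt j).le)
      linarith
    have hz := (Finset.sum_eq_zero_iff_of_nonneg hnn).mp
      (by rw [Finset.sum_sub_distrib, hsum, sub_self])
    have hz' : ∀ j, |x j| ≤ 0 := fun j => by
      have h1 : x j * (1 - x j ^ 2) = 0 := by linarith [hz j (Finset.mem_univ j)]
      rcases mul_eq_zero.mp h1 with h2 | h2
      · simp [h2]
      · linarith [hlt j]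
    have := le_of_index_one hN hγ hind hz'
    linarith
  have hMε : M ≤ 1 - ε := (le_abs_self _).trans (hb i)
  have hM1 : M ≤ 1 := by linarith
  have hM2 : M ^ 2 ≤ 1 - ε := by nlinarith
  have hden : 0 < 2 - M ^ 2 := by linarith
  set s := M ^ 2 / (2 - M ^ 2) with hs
  have hs0 : 0 ≤ s := by positivity
  have hsε : s ≤ 1 - ε := by
    rw [hs, div_le_iff₀ hden]
    nlinarith
  have hMs : M ^ 2 * (1 + s) = 2 * s := by
    rw [hs]
    field_simp
    ring
  obtain ⟨hp0, hp1⟩ := increment_at_max hh hhγ hst hi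
  have hP0 : |(x i - x (i - 1)) / h| ≤ h * M := by
    rw [abs_of_nonneg hp0]
    refine hp1.trans (mul_le_mul_of_nonneg_left ?_ hh.le)
    have h1 := abs_fdrift_le (a := x i) (by linarith [hb i])
    rw [abs_of_pos hM0] at h1
    exact (le_abs_self _).trans h1
  have hO := isEulerOrbit_of_equilibrium hh hhγ hst i
  obtain ⟨hbd, m, hm1, hm2⟩ := hC hO hh hh1 hNh hs0 hsε hM0 hM1 hMs
    (fun n => by linarith [hb (i + n)]) (by simp [hMdef]) (by simpa using hP0)
    (by simp [hMdef]) (by simp)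
  rw [sum_range_shift (fun j => x j ^ 4) i] at hm2
  have hCC : C ≤ C + 6 * C ^ 2 := by linarith [sq_nonneg C]
  refine ⟨s, hs0, hsε, ?_, m, hm1.trans (by gcongr), hm2.trans (by gcongr)⟩
  have hB : ∀ j, |x j| ≤ C * M := fun j => by
    have := hbd (j - i).val (ZMod.val_lt _).le
    rwa [ZMod.natCast_zmod_val, add_sub_cancel] at this
  have h1 := le_of_index_one hN hγ hind hB
  have h2 : M ^ 2 ≤ 2 * s := by nlinarith [sq_nonneg M]
  nlinarith [sq_nonneg C, mul_le_mul_of_nonneg_left h2 (sq_nonneg C), mul_nonneg hC0.le hs0]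

/-- The winding number of the orbit approximating a saddle of index one is `1`, and its modulus
is close to the one determined by the coupling. -/
theorem period_count_eq_one {C h n s r g : ℝ} {m : ℤ} (hC : 0 < C) (hh : 0 < h)
    (hCh : (C + 1) ^ 2 * h ≤ 1 / 2) (hs0 : 0 ≤ s) (hs1 : s < 1) (hr0 : 0 ≤ r) (hr1 : r < 1)
    (hlow : 4 ≤ n * h) (hupp : n * h ≤ 4 * Real.pi) (hg : 1 - g ≤ C * s)
    (hgT : g * orbitPeriod r ^ 2 = 4 * Real.pi ^ 2) (hT : n * h ≤ orbitPeriod r)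
    (hT3 : orbitPeriod r - n * h ≤ 3 * h) (hm : |n * h - m * orbitPeriod s| ≤ C * h) :
    m = 1 ∧ |s - r| ≤ (C + 3) * h := by
  have hCh1 : C * h ≤ 1 / 2 := by nlinarith
  have hCh2 : C ^ 2 * h ≤ 1 / 2 := by nlinarith
  have hTs := orbitPeriod_ge hs0 hs1
  have hπ := Real.pi_gt_d2
  have hπ' := Real.pi_lt_d2
  rw [abs_le] at hm
  have hm1 : 1 ≤ m := by
    by_contra! hlt
    have : (m : ℝ) ≤ 0 := by exact_mod_cast Int.lt_add_one_iff.mp hlt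
    nlinarith
  have hm2 : m ≤ 1 := by
    by_contra! hlt
    have h2 : (2 : ℝ) ≤ m := by exact_mod_cast hlt
    have h3 : 2 * orbitPeriod s ≤ m * orbitPeriod s :=
      mul_le_mul_of_nonneg_right h2 (by linarith)
    have h4 : 4 * s ≤ C * h := by linarith
    have h5 : 12 ≤ orbitPeriod r := by linarith
    have h6 : C * s ≤ 1 / 8 := by nlinarith
    have h7 : 7 / 8 ≤ g := by linarith
    nlinarith
  have hm0 : m = 1 := le_antisymm hm2 hm1
  refine ⟨hm0, ?_⟩
  rw [hm0, Int.cast_one, one_mul] at hm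
  rw [abs_le]
  rcases le_total s r with h | h
  · have := orbitPeriod_sub_ge hs0 h hr1
    constructor <;> nlinarith
  · have := orbitPeriod_sub_ge hr0 h hs1
    constructor <;> nlinarith

/-- Comparison of means over the lattice and over the orbit, away from the bifurcation. -/
theorem abs_mean_sub_le {C ε h n s r S : ℝ} (hC : 0 < C) (hε : 0 < ε) (hh : 0 < h)
    (hs0 : 0 ≤ s) (hsε : s ≤ 1 - ε) (hr0 : 0 ≤ r) (hrε : r ≤ 1 - ε) (hhr : h ≤ r)
    (hsr : |s - r| ≤ (C + 3) * h) (hlow : 4 ≤ n * h) (hT : n * h ≤ orbitPeriod r)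
    (hT3 : orbitPeriod r - n * h ≤ 3 * h)
    (hS : |h * S - orbitQuartic s| ≤ C * (h * s ^ 2)) :
    |S / n - orbitQuartic r / orbitPeriod r|
      ≤ (C * (C + 4) + 96 / ε ^ 2 * ((C + 5) * (C + 3)) + 3) * (h * r) := by
  have hT0 : 0 < orbitPeriod r := by linarith
  have hn0 : 0 < n := pos_of_mul_pos_left (by linarith) hh.le
  have hnh : 0 < n * h := by linarith
  have hsr' : s ≤ (C + 4) * r := by
    have h1 := (abs_le.mp hsr).2
    nlinarith [mul_le_mul_of_nonneg_left hhr (by linarith : 0 ≤ C + 3)]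
  have hE1 : C * (h * s ^ 2) ≤ C * (C + 4) * (h * r) := by
    have h1 : s ^ 2 ≤ s := by nlinarith
    calc C * (h * s ^ 2) ≤ C * (h * ((C + 4) * r)) := by gcongr; exact h1.trans hsr'
      _ = _ := by ring
  have hE2 : |orbitQuartic s - orbitQuartic r| ≤ 96 / ε ^ 2 * ((C + 5) * (C + 3)) * (h * r) := by
    refine (abs_orbitQuartic_sub_le hε hs0 hr0 hsε hrε).trans ?_
    have h1 : s + r ≤ (C + 5) * r := by linarith
    calc 96 / ε ^ 2 * ((s + r) * |s - r|)
        ≤ 96 / ε ^ 2 * ((C + 5) * r * ((C + 3) * h)) := by gcongr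
      _ = _ := by ring
  have hJ := orbitQuartic_le hr0 (by linarith : r < 1)
  have hJ0 : 0 ≤ orbitQuartic r := orbitQuartic_nonneg
  set J := orbitQuartic r
  set T := orbitPeriod r
  have hE : |h * S - J| ≤ (C * (C + 4) + 96 / ε ^ 2 * ((C + 5) * (C + 3))) * (h * r) := by
    refine (abs_sub_le _ (orbitQuartic s) _).trans ?_
    linarith
  have e : S / n - J / T = (h * S - J) / (n * h) + J * (T - n * h) / (T * (n * h)) := by
    field_simp
    ring
  rw [e]
  refine (abs_add_le _ _).trans ?_
  have b1 : |(h * S - J) / (n * h)| ≤ |h * S - J| := by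
    rw [abs_div, abs_of_pos hnh]
    exact div_le_self (abs_nonneg _) (by linarith)
  have b2 : |J * (T - n * h) / (T * (n * h))| ≤ 3 * (h * r) := by
    rw [abs_of_nonneg (by have := sub_nonneg.mpr hT; positivity), div_le_iff₀ (by positivity)]
    calc J * (T - n * h) ≤ 4 * r ^ 2 * T * (3 * h) :=
          mul_le_mul hJ hT3 (by linarith) (by positivity)
      _ = 3 * (h * r) * (T * (4 * r)) := by ring
      _ ≤ 3 * (h * r) * (T * (n * h)) := by
        have h4r : 4 * r ≤ n * h := by linarith
        exact mul_le_mul_of_nonneg_left (mul_le_mul_of_nonneg_left h4r hT0.le) (by positivity)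
  linarith

/-- Comparison of means over the lattice and over the orbit, near the bifurcation. -/
theorem abs_mean_sub_le_of_small {ε h n r g S : ℝ} (hε : 0 < ε) (hn : 0 < n)
    (hr0 : 0 ≤ r) (hr1 : r < 1) (hrh : r ≤ h) (hg : g ≤ 1)
    (hgT : g * orbitPeriod r ^ 2 = 4 * Real.pi ^ 2) (hS0 : 0 ≤ S)
    (hS : S ≤ n * (1 - g) ^ 2 / ε ^ 2) :
    |S / n - orbitQuartic r / orbitPeriod r| ≤ (4 / ε ^ 2 + 4) * (h * r) := by
  have hπ := Real.pi_pos
  have hT0 : 0 < orbitPeriod r := by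
    have := orbitPeriod_ge hr0 hr1
    linarith
  have hJ := orbitQuartic_le hr0 hr1
  have hJ0 : 0 ≤ orbitQuartic r := orbitQuartic_nonneg
  have hT2 := orbitPeriod_sq_le hr0 hr1
  have h1r : 0 < 1 - r := by linarith
  have hg0 : 0 < g := by
    refine pos_of_mul_pos_left ?_ (sq_nonneg (orbitPeriod r))
    rw [hgT]
    positivity
  have hgr : 1 - g ≤ 2 * r := by
    have h1 : 4 * Real.pi ^ 2 * 1 ≤ 4 * Real.pi ^ 2 * (g * ((1 + r) / (1 - r))) := by
      calc 4 * Real.pi ^ 2 * 1 = g * orbitPeriod r ^ 2 := by rw [hgT, mul_one]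
        _ ≤ g * (4 * Real.pi ^ 2 * ((1 + r) / (1 - r))) := by gcongr
        _ = _ := by ring
    have h2 := le_of_mul_le_mul_left h1 (by positivity)
    rw [← mul_div_assoc, le_div_iff₀ h1r] at h2
    nlinarith
  have hmean : S / n ≤ 4 / ε ^ 2 * r ^ 2 := by
    rw [div_le_iff₀ hn]
    refine hS.trans ?_
    have : (1 - g) ^ 2 ≤ (2 * r) ^ 2 := pow_le_pow_left₀ (by linarith) hgr 2
    calc n * (1 - g) ^ 2 / ε ^ 2 ≤ n * (2 * r) ^ 2 / ε ^ 2 := by gcongr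
      _ = _ := by ring
  have hmean0 : 0 ≤ S / n := by positivity
  have hJT : orbitQuartic r / orbitPeriod r ≤ 4 * r ^ 2 := by rwa [div_le_iff₀ hT0]
  have hJT0 : 0 ≤ orbitQuartic r / orbitPeriod r := by positivity
  have hrr : r ^ 2 ≤ h * r := by nlinarith
  have hc : (4 / ε ^ 2 + 4) * r ^ 2 ≤ (4 / ε ^ 2 + 4) * (h * r) := by gcongr
  have hε2 : 0 ≤ 4 / ε ^ 2 * r ^ 2 := by positivity
  rw [abs_le]
  constructor <;> nlinarith [sq_nonneg r]

set_option maxHeartbeats 1000000 in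
/-- Theorem 2.1, barrier height: there exist `N₁` and `c > 0` such that
for `N ≥ N₁`, `γ̃₂ < γ̃ < 1`, and `κ ∈ (0,1)` the solution of
`γ̃ = π²/(4K(κ)²(1+κ²))`, every 1-saddle `A` of `V_γ` satisfies
`|(V_γ(A) − V_γ(I⁺))/N − 1/4 + (1/(3(1+κ²)))[(2+κ²)/(1+κ²) − 2E(κ)/K(κ)]| ≤ cκ²/N`. -/
theorem statement17 :
    ∃ (N₁ : ℕ) (c : ℝ), 0 < c ∧
      ∀ (N : ℕ) [NeZero N], N₁ ≤ N →
        ∀ γ : ℝ, 0 < γ → gammaM N 2 < γ → γ < gammaM N 1 →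
          ∀ κ : ℝ, 0 < κ → κ < 1 →
            γ / gammaM N 1 = Real.pi^2 / (4 * ellK κ^2 * (1 + κ^2)) →
            ∀ A : ZMod N → ℝ, IsKSaddle N γ 1 A →
              |(V N γ A - V N γ (Iplus N)) / N - 1/4
                + (1/(3*(1+κ^2))) * ((2+κ^2)/(1+κ^2) - 2 * ellE κ / ellK κ)|
                ≤ c * κ^2 / N := by
  obtain ⟨C, hC0, hC⟩ := exists_orbit_of_saddle
  set ε := Real.exp (-52) / 3 with hε
  have hε0 : 0 < ε := by positivity
  have hε1 : ε ≤ 1 := by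
    have : Real.exp (-52) ≤ 1 := Real.exp_le_one_iff.mpr (by norm_num)
    linarith
  set δ := ε / (2 * (C + 3) ^ 2) with hδ
  have hδ0 : 0 < δ := by positivity
  set D := (C * (C + 4) + 96 / (ε / 2) ^ 2 * ((C + 5) * (C + 3)) + 3) + (4 / ε ^ 2 + 4) with hD
  have hD0 : 0 < D := by positivity
  refine ⟨⌈13 / δ⌉₊ + 8, 13 * D, by positivity, ?_⟩
  rintro N _ hN γ hγ hγ2 hγ1 κ hκ0 hκ1 heq A ⟨hA, -, hind⟩
  obtain ⟨h, hh0, hhγ, hlow, hupp, hg1, hgT, hT, hT3⟩ :=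
    exists_step (by omega) hγ hγ2 hγ1 hκ0 hκ1 heq
  have hN0 : (0 : ℝ) < N := Nat.cast_pos.mpr (by omega)
  have hNh : N * h ≤ 13 := by linarith [Real.pi_lt_d2]
  have hhδ : h ≤ δ := by
    have h1 : 13 / δ ≤ N := (Nat.le_ceil _).trans (Nat.cast_le.mpr (by omega))
    rw [div_le_iff₀ hδ0] at h1
    exact le_of_mul_le_mul_left (hNh.trans h1) hN0
  have hCh : (C + 3) ^ 2 * h ≤ ε / 2 := by
    rw [hδ, le_div_iff₀ (by positivity)] at hhδ
    linarith
  have hCh' : (C + 3) * h ≤ ε / 2 := by nlinarith [mul_pos hC0 hh0]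
  have hh1 : h ≤ 1 := by nlinarith [mul_pos hC0 hh0]
  have hκ2 : κ ^ 2 < 1 := by nlinarith
  have hκ2' : 0 ≤ κ ^ 2 := sq_nonneg κ
  obtain ⟨s, hs0, hsε, hgs, m, hm, hJ⟩ :=
    hC (by omega) hγ hh0 hh1 hhγ hNh hg1 hA hind
  have hb := abs_le_of_index_one hγ hh0 hh1 hhγ hNh hA hind
  have hS := sum_pow_four_le hγ hg1.le hA hε0 hb
  have hS0 : 0 ≤ ∑ i, A i ^ 4 := Finset.sum_nonneg fun i _ => by positivity
  obtain ⟨hm1, hsr⟩ := period_count_eq_one hC0 hh0 (by nlinarith [mul_pos hC0 hh0]) hs0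
    (by linarith) hκ2' hκ2 hlow hupp hgs hgT hT hT3 hm
  rw [hm1, Int.cast_one, one_mul] at hJ
  have hmean : |(∑ i, A i ^ 4) / N - orbitQuartic (κ ^ 2) / orbitPeriod (κ ^ 2)|
      ≤ D * (h * κ ^ 2) := by
    have hhκ : 0 ≤ h * κ ^ 2 := by positivity
    rcases le_total h (κ ^ 2) with hle | hle
    · refine (abs_mean_sub_le hC0 (half_pos hε0) hh0 hs0 (by linarith) hκ2' ?_ hle hsr hlow hT hT3
        hJ).trans ?_
      · linarith [(abs_le.mp hsr).1]
      · refine mul_le_mul_of_nonneg_right ?_ hhκ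
        exact le_add_of_nonneg_right (by positivity)
    · refine (abs_mean_sub_le_of_small hε0 hN0 hκ2' hκ2 hle hg1.le hgT hS0 hS).trans ?_
      refine mul_le_mul_of_nonneg_right ?_ hhκ
      exact le_add_of_nonneg_left (by positivity)
  rw [orbitQuartic_div_orbitPeriod hκ0 hκ1, V_stationary hA, V_Iplus]
  have e : (-(1 / 4) * ∑ i, A i ^ 4 - -((N : ℝ) / 4)) / N - 1 / 4
      + 1 / 4 * (orbitQuartic (κ ^ 2) / orbitPeriod (κ ^ 2))
      = -(1 / 4 * ((∑ i, A i ^ 4) / N - orbitQuartic (κ ^ 2) / orbitPeriod (κ ^ 2))) := by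
    field_simp
    ring
  rw [e, abs_neg, abs_mul, abs_of_pos (by norm_num : (0 : ℝ) < 1 / 4), le_div_iff₀ hN0]
  have hfin : D * (h * κ ^ 2) * N ≤ 13 * D * κ ^ 2 := by
    calc D * (h * κ ^ 2) * N = D * κ ^ 2 * (N * h) := by ring
      _ ≤ D * κ ^ 2 * 13 := by gcongr
      _ = _ := by ring
  have hmN := mul_le_mul_of_nonneg_right hmean hN0.le
  have := mul_nonneg (abs_nonneg ((∑ i, A i ^ 4) / (N : ℝ)
    - orbitQuartic (κ ^ 2) / orbitPeriod (κ ^ 2))) hN0.le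
  linarith
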